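/- Let 0 ≤ s < 1 and ε > 0. There exist ε' > 0 and C > 0 depending only on s and ε such that: for every N ≥ 2, every admissible low symbol m (with parameters N, s) with associated multiplier I, every t₀ ∈ ℝ, every 0 < δ ≤ 1, and all Schwartz functions u₁,…,u₆ : ℝ×ℝ→ℂ, one has |∫_{t₀}^{t₀+δ} Λ₆(M₆; u₁(·,t), \overline{u₂(·,t)}, u₃(·,t), \overline{u₄(·,t)}, u₅(·,t), \overline{u₆(·,t)}) dt| ≤ C N^{−1+ε} ∏_{i=1}^6 ‖I uᵢ‖_{X^{1,1/2+ε'}}, where M₆(ξ₁,…,ξ₆) := m(ξ₁+ξ₂+ξ₃) m(ξ₄) m(ξ₅) m(ξ₆) − m(ξ₁) m(ξ₂) m(ξ₃) m(ξ₄+ξ₅+ξ₆). -/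

import Mathlib

open MeasureTheory Real

noncomputable section

/-- The Fourier transform on `ℝ`: `f̂(ξ) = ∫ e^{-ixξ} f(x) dx`. -/
def ft (f : ℝ → ℂ) (ξ : ℝ) : ℂ := ∫ x : ℝ, Complex.exp (-Complex.I * x * ξ) * f x

/-- The Japanese bracket `⟨ξ⟩ = 1 + |ξ|`. -/
def jap (ξ : ℝ) : ℝ := 1 + |ξ|

/-- The Sobolev norm `‖f‖_{H^s} = (∫ ⟨ξ⟩^{2s} |f̂(ξ)|² dξ)^{1/2}`. -/
def HsNorm (s : ℝ) (f : ℝ → ℂ) : ℝ :=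
  (∫ ξ : ℝ, jap ξ ^ (2 * s) * ‖ft f ξ‖ ^ 2) ^ ((1 : ℝ) / 2)

/-- The squared `L²` norm. -/
def L2sq (f : ℝ → ℂ) : ℝ := ∫ x : ℝ, ‖f x‖ ^ 2

/-- The spacetime Fourier transform (x first variable, t second). -/
def stft (u : ℝ → ℝ → ℂ) (ξ τ : ℝ) : ℂ :=
  ∫ t : ℝ, ∫ x : ℝ, Complex.exp (-Complex.I * (x * ξ + t * τ)) * u x t

/-- The `X^{s,b}` norm. -/
def XsbNorm (s b : ℝ) (u : ℝ → ℝ → ℂ) : ℝ :=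
  (∫ ξ : ℝ, ∫ τ : ℝ,
    jap ξ ^ (2 * s) * jap (τ - ξ ^ 2) ^ (2 * b) * ‖stft u ξ τ‖ ^ 2) ^ ((1 : ℝ) / 2)

/-- The Fourier multiplier with symbol `θ`: `(mult θ f)̂(ξ) = θ(ξ) f̂(ξ)`. -/
def mult (θ : ℝ → ℝ) (f : ℝ → ℂ) (x : ℝ) : ℂ :=
  (2 * π)⁻¹ • ∫ ξ : ℝ, Complex.exp (Complex.I * x * ξ) * (θ ξ : ℂ) * ft f ξ

/-- The multiplier applied in the `x`-variable of a spacetime function. -/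
def multX (θ : ℝ → ℝ) (u : ℝ → ℝ → ℂ) (x t : ℝ) : ℂ := mult θ (fun y => u y t) x

/-- The cubic nonlinearity `F(z) = |z|² z`. -/
def Fnl (z : ℂ) : ℂ := (‖z‖ : ℂ) ^ 2 * z

/-- The real inner product `⟨f,g⟩ = Re ∫ f ḡ`. -/
def rip (f g : ℝ → ℂ) : ℝ := (∫ x : ℝ, f x * (starRingEnd ℂ) (g x)).re

/-- The Lyapunov functional `L(u) = ∫ |∂ₓu|² + |u|² - ½|u|⁴`. -/
def Lfun (f : ℝ → ℂ) : ℝ :=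
  ∫ x : ℝ, (‖deriv f x‖ ^ 2 + ‖f x‖ ^ 2
    - (1 / 2) * ‖f x‖ ^ 4)

/-- The Lyapunov functional with the `H¹`-part expressed on the Fourier side
(Plancherel form), suitable for `H¹` functions. -/
def LfunH1 (f : ℝ → ℂ) : ℝ :=
  (2 * π)⁻¹ * (∫ ξ : ℝ, (ξ ^ 2 + 1) * ‖ft f ξ‖ ^ 2)
    - (1 / 2) * ∫ x : ℝ, ‖f x‖ ^ 4

/-- Membership in `H¹(ℝ)`. -/
def MemH1 (f : ℝ → ℂ) : Prop :=
  MemLp f 2 (volume : Measure ℝ) ∧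
    Integrable (fun ξ : ℝ => jap ξ ^ (2 : ℝ) * ‖ft f ξ‖ ^ 2)

/-- The ground state `Q(x) = 2^{-1/2} / cosh x`. -/
def Qgs (x : ℝ) : ℝ := (Real.sqrt 2)⁻¹ / Real.cosh x

/-- A point `e^{iα} Q(· - x₀)` of the ground state cylinder. -/
def Qcyl (α x₀ : ℝ) (x : ℝ) : ℂ := Complex.exp (Complex.I * α) * (Qgs (x - x₀) : ℂ)

/-- The ground state cylinder `Σ`. -/
def groundCyl : Set (ℝ → ℂ) := { f | ∃ α x₀ : ℝ, f = Qcyl α x₀ }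

/-- `dist_{H^s}(f, Σ)`. -/
def distHs (s : ℝ) (f : ℝ → ℂ) : ℝ :=
  ⨅ v ∈ groundCyl, HsNorm s (fun x => f x - v x)

/-- A smooth function `u(x,t)` all of whose `x`-derivatives are rapidly decreasing
in `x`, locally uniformly in `t`. -/
structure IsSchwartzInX (u : ℝ → ℝ → ℂ) : Prop where
  smooth : ContDiff ℝ (⊤ : ℕ∞) (fun p : ℝ × ℝ => u p.1 p.2)
  decay : ∀ (k n : ℕ) (T : ℝ), 0 < T → ∃ C : ℝ, ∀ x t : ℝ, |t| ≤ T →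
    |x| ^ k * ‖iteratedDeriv n (fun y => u y t) x‖ ≤ C

/-- A smooth Schwartz solution of the focusing cubic NLS `iu_t + u_xx = -|u|²u`. -/
structure IsSchwartzSolution (u : ℝ → ℝ → ℂ) extends IsSchwartzInX u : Prop where
  eqn : ∀ x t : ℝ, Complex.I * deriv (fun τ => u x τ) t
      + iteratedDeriv 2 (fun y => u y t) x
      = -((‖u x t‖ : ℂ) ^ 2 * u x t)

/-- A Schwartz function on spacetime. -/
def IsSchwartz2 (u : ℝ → ℝ → ℂ) : Prop :=
  ∃ g : SchwartzMap (ℝ × ℝ) ℂ, ∀ x t : ℝ, u x t = g (x, t)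

/-- An admissible high symbol `θ` with parameters `N`, `s`. -/
structure AdmissibleHigh (N s : ℝ) (θ : ℝ → ℝ) : Prop where
  smooth : ContDiff ℝ (⊤ : ℕ∞) θ
  even : ∀ ξ : ℝ, θ (-ξ) = θ ξ
  eq_one : ∀ ξ : ℝ, |ξ| ≤ N → θ ξ = 1
  eq_high : ∀ ξ : ℝ, 2 * N ≤ |ξ| → θ ξ = |ξ| ^ s * N ^ (-s)
  mono : ∀ ξ η : ℝ, |ξ| ≤ |η| → θ ξ ≤ θ η
  deriv1 : ∀ ξ : ℝ, |deriv (fun ζ => θ ζ ^ 2) ξ| ≤ 10 * θ ξ ^ 2 / jap ξ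
  deriv2 : ∀ ξ : ℝ, |iteratedDeriv 2 (fun ζ => θ ζ ^ 2) ξ| ≤ 10 * θ ξ ^ 2 / jap ξ ^ 2

/-- An admissible low symbol `m` with parameters `N`, `s`. -/
structure AdmissibleLow (N s : ℝ) (m : ℝ → ℝ) : Prop where
  smooth : ContDiff ℝ (⊤ : ℕ∞) m
  even : ∀ ξ : ℝ, m (-ξ) = m ξ
  eq_one : ∀ ξ : ℝ, |ξ| ≤ N → m ξ = 1
  eq_high : ∀ ξ : ℝ, 2 * N ≤ |ξ| → m ξ = |ξ| ^ (s - 1) * N ^ (1 - s)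
  anti : ∀ ξ η : ℝ, |ξ| ≤ |η| → m η ≤ m ξ
  mono : ∀ ξ η : ℝ, |ξ| ≤ |η| → m ξ * jap ξ ≤ m η * jap η
  deriv1 : ∀ ξ : ℝ, |deriv m ξ| ≤ 10 * m ξ / jap ξ
  deriv2 : ∀ ξ : ℝ, |iteratedDeriv 2 m ξ| ≤ 10 * m ξ / jap ξ ^ 2

/-- The multilinear form `Λ₄` on the hyperplane `ξ₁+ξ₂+ξ₃+ξ₄ = 0`. -/
def Lam4 (M : ℝ → ℝ → ℝ → ℝ → ℝ) (f₁ f₂ f₃ f₄ : ℝ → ℂ) : ℂ :=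
  ∫ ξ₁ : ℝ, ∫ ξ₂ : ℝ, ∫ ξ₃ : ℝ,
    (M ξ₁ ξ₂ ξ₃ (-(ξ₁ + ξ₂ + ξ₃)) : ℂ) * ft f₁ ξ₁ * ft f₂ ξ₂ * ft f₃ ξ₃
      * ft f₄ (-(ξ₁ + ξ₂ + ξ₃))

/-- The multilinear form `Λ₆` on the hyperplane `ξ₁+⋯+ξ₆ = 0`. -/
def Lam6 (M : ℝ → ℝ → ℝ → ℝ → ℝ → ℝ → ℝ) (f₁ f₂ f₃ f₄ f₅ f₆ : ℝ → ℂ) : ℂ :=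
  ∫ ξ₁ : ℝ, ∫ ξ₂ : ℝ, ∫ ξ₃ : ℝ, ∫ ξ₄ : ℝ, ∫ ξ₅ : ℝ,
    (M ξ₁ ξ₂ ξ₃ ξ₄ ξ₅ (-(ξ₁ + ξ₂ + ξ₃ + ξ₄ + ξ₅)) : ℂ) * ft f₁ ξ₁ * ft f₂ ξ₂
      * ft f₃ ξ₃ * ft f₄ ξ₄ * ft f₅ ξ₅ * ft f₆ (-(ξ₁ + ξ₂ + ξ₃ + ξ₄ + ξ₅))

/-- The complex conjugate of a function. -/
def cj (f : ℝ → ℂ) : ℝ → ℂ := fun x => (starRingEnd ℂ) (f x)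

open scoped FourierTransform SchwartzMap ENNReal

theorem ft_eq_fourier (f : ℝ → ℂ) (ξ : ℝ) : ft f ξ = 𝓕 f (ξ / (2 * π)) := by
  rw [Real.fourier_real_eq_integral_exp_smul]
  unfold ft
  refine integral_congr_ae (.of_forall fun x => ?_)
  have : (π : ℂ) ≠ 0 := by exact_mod_cast pi_ne_zero
  simp only [smul_eq_mul]
  congr 2
  push_cast
  field_simp

theorem exists_scaling_equiv (E : Type*) [NormedAddCommGroup E] [NormedSpace ℝ E] :
    ∃ e : E ≃L[ℝ] E, ∀ x, e x = (2 * π)⁻¹ • x :=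
  ⟨ContinuousLinearEquiv.smulLeft (Units.mk0 ((2 * π)⁻¹ : ℝ) (by positivity)), fun _ => rfl⟩

theorem ft_inversion {f : ℝ → ℂ} (hc : Continuous f) (hi : Integrable f)
    (hf : Integrable (ft f)) (x : ℝ) :
    f x = (2 * π : ℝ)⁻¹ • ∫ ξ : ℝ, Complex.exp (Complex.I * x * ξ) * ft f ξ := by
  have h1 : ft f = fun ξ => 𝓕 f (ξ / (2 * π)) := funext (ft_eq_fourier f)
  have h2 : Integrable (𝓕 f) := by
    rw [h1] at hf
    refine (hf.comp_mul_right' (R := 2 * π) (by positivity)).congr (.of_forall fun y => ?_)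
    have : 2 * π ≠ 0 := by positivity
    simp only [mul_div_cancel_right₀ y this]
  have h3 := congrFun (hc.fourierInv_fourier_eq hi h2) x
  rw [← h3, Real.fourierInv_eq_fourier_neg, Real.fourier_real_eq_integral_exp_smul]
  have h4 := Measure.integral_comp_div (fun y : ℝ =>
    Complex.exp (↑(-2 * π * y * -x) * Complex.I) • 𝓕 f y) (2 * π)
  rw [abs_of_pos (by positivity)] at h4
  rw [eq_inv_smul_iff₀ (by positivity)]
  rw [← h4]
  refine integral_congr_ae (.of_forall fun ξ => ?_)
  have : (π : ℂ) ≠ 0 := by exact_mod_cast pi_ne_zero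
  simp only [smul_eq_mul, h1]
  congr 2
  push_cast
  field_simp

theorem exists_schwartz_slice (g : 𝓢(ℝ × ℝ, ℂ)) (t : ℝ) :
    ∃ ψ : 𝓢(ℝ, ℂ), ∀ x, ψ x = g (x, t) := by
  refine ⟨SchwartzMap.compCLM ℝ (g := fun x : ℝ => (x, t)) ?_ ⟨1, 1, fun x => ?_⟩ g, fun x => rfl⟩
  · have : (fun x : ℝ => (x, t)) = fun x => ContinuousLinearMap.inl ℝ ℝ ℝ x + (0, t) := by
      ext x <;> simp
    rw [this]
    exact (ContinuousLinearMap.hasTemperateGrowth _).add (Function.HasTemperateGrowth.const _)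
  · have := norm_fst_le ((x, t) : ℝ × ℝ)
    simp only [pow_one, one_mul] at *
    linarith

theorem exists_schwartz_ft (f : 𝓢(ℝ, ℂ)) : ∃ ψ : 𝓢(ℝ, ℂ), ∀ ξ, ψ ξ = ft f ξ := by
  obtain ⟨c, hc⟩ := exists_scaling_equiv ℝ
  refine ⟨SchwartzMap.compCLMOfContinuousLinearEquiv ℝ c (𝓕 f), fun ξ => ?_⟩
  rw [ft_eq_fourier, SchwartzMap.compCLMOfContinuousLinearEquiv_apply, SchwartzMap.fourier_coe]
  simp only [Function.comp, hc, smul_eq_mul, div_eq_inv_mul]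

theorem exists_schwartz_stft (g : 𝓢(ℝ × ℝ, ℂ)) :
    ∃ H : 𝓢(ℝ × ℝ, ℂ), ∀ ξ τ, H (ξ, τ) = stft (fun x t => g (x, t)) ξ τ := by
  set e := WithLp.prodContinuousLinearEquiv 2 ℝ ℝ ℝ with he
  set G : 𝓢(WithLp 2 (ℝ × ℝ), ℂ) := SchwartzMap.compCLMOfContinuousLinearEquiv ℝ e g with hG
  obtain ⟨c, hc⟩ := exists_scaling_equiv (ℝ × ℝ)
  refine ⟨SchwartzMap.compCLMOfContinuousLinearEquiv ℝ (c.trans e.symm) (𝓕 G), fun ξ τ => ?_⟩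
  rw [SchwartzMap.compCLMOfContinuousLinearEquiv_apply, SchwartzMap.fourier_coe]
  simp only [Function.comp]
  rw [Real.fourier_eq']
  unfold stft
  rw [← (WithLp.volume_preserving_toLp (U := ℝ) (V := ℝ)).integral_comp
    (MeasurableEquiv.toLp 2 (ℝ × ℝ)).measurableEmbedding]
  have h_int : Integrable (fun p : ℝ × ℝ =>
      Complex.exp (-Complex.I * (p.1 * ξ + p.2 * τ)) * g p) := by
    refine (g.integrable (μ := volume)).norm.mono' (by fun_prop) (.of_forall fun p => ?_)
    rw [norm_mul, Complex.norm_exp]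
    simp
  have h2 : (∫ t : ℝ, ∫ x : ℝ, Complex.exp (-Complex.I * (x * ξ + t * τ)) * g (x, t)) =
      ∫ p : ℝ × ℝ, Complex.exp (-Complex.I * (p.1 * ξ + p.2 * τ)) * g p := by
    rw [Measure.volume_eq_prod] at h_int ⊢
    exact (integral_prod_symm _ h_int).symm
  rw [h2]
  refine integral_congr_ae (.of_forall fun p => ?_)
  have : (π : ℂ) ≠ 0 := by exact_mod_cast pi_ne_zero
  have hGp : G (WithLp.toLp 2 p) = g p := rfl
  simp only [smul_eq_mul, hGp]
  congr 2
  simp only [he, ContinuousLinearEquiv.trans_apply, hc, WithLp.prodContinuousLinearEquiv_symm_apply,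
    WithLp.prod_inner_apply, Prod.smul_fst, Prod.smul_snd, smul_eq_mul, RCLike.inner_apply,
    conj_trivial]
  push_cast
  field_simp

theorem one_le_jap (ξ : ℝ) : 1 ≤ jap ξ := by
  unfold jap; linarith [abs_nonneg ξ]

theorem jap_pos (ξ : ℝ) : 0 < jap ξ := lt_of_lt_of_le one_pos (one_le_jap ξ)

theorem continuous_jap : Continuous jap := by unfold jap; fun_prop

namespace AdmissibleLow

variable {N s : ℝ} {m : ℝ → ℝ}

theorem one_le_mul_jap (h : AdmissibleLow N s m) (hN : 2 ≤ N) (ξ : ℝ) : 1 ≤ m ξ * jap ξ := by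
  have h1 := h.mono 0 ξ (by simp)
  rw [h.eq_one 0 (by simp; linarith)] at h1
  simpa [jap] using h1

theorem pos (h : AdmissibleLow N s m) (hN : 2 ≤ N) (ξ : ℝ) : 0 < m ξ :=
  pos_of_mul_pos_left (lt_of_lt_of_le one_pos (h.one_le_mul_jap hN ξ)) (jap_pos ξ).le

theorem le_one (h : AdmissibleLow N s m) (hN : 2 ≤ N) (ξ : ℝ) : m ξ ≤ 1 := by
  have h1 := h.anti 0 ξ (by simp)
  rwa [h.eq_one 0 (by simp; linarith)] at h1

theorem div_le_mul_jap (h : AdmissibleLow N s m) (hN : 2 ≤ N) {ξ : ℝ} (hξ : N / 15 ≤ |ξ|) :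
    N / 15 ≤ m ξ * jap ξ := by
  rcases le_total |ξ| N with h1 | h1
  · rw [h.eq_one ξ h1, one_mul]; unfold jap; linarith
  · have h2 := h.mono N ξ (by rwa [abs_of_nonneg (by linarith)])
    rw [h.eq_one N (by rw [abs_of_nonneg (by linarith)])] at h2
    have : jap N = 1 + N := by unfold jap; rw [abs_of_nonneg (by linarith)]
    linarith

theorem abs_deriv_le (h : AdmissibleLow N s m) (hN : 2 ≤ N) (ξ : ℝ) : |deriv m ξ| ≤ 10 := by
  refine (h.deriv1 ξ).trans ?_
  rw [div_le_iff₀ (jap_pos ξ)]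
  nlinarith [one_le_jap ξ, h.le_one hN ξ]

theorem abs_deriv2_le (h : AdmissibleLow N s m) (hN : 2 ≤ N) (ξ : ℝ) :
    |deriv (deriv m) ξ| ≤ 10 := by
  have h1 := h.deriv2 ξ
  rw [iteratedDeriv_succ, iteratedDeriv_one] at h1
  refine h1.trans ?_
  have := one_le_jap ξ
  rw [div_le_iff₀ (by positivity)]
  nlinarith [h.le_one hN ξ]

end AdmissibleLow

theorem integrable_ft_of_contDiff {g : ℝ → ℂ} (hg : ContDiff ℝ 2 g) (h0 : Integrable g)
    (h1 : Integrable (deriv g)) (h2 : Integrable (deriv (deriv g))) : Integrable (ft g) := by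
  have hd : ContDiff ℝ 1 (deriv g) := ((contDiff_succ_iff_deriv (n := 1)).1 hg).2.2
  have e1 := Real.fourier_deriv h0 (hg.differentiable (by norm_num)) h1
  have e2 := Real.fourier_deriv h1 (hd.differentiable (by norm_num)) h2
  rw [e1] at e2
  have hF : Integrable (𝓕 g) := by
    have hb : ∀ (f : ℝ → ℂ) x, ‖𝓕 f x‖ ≤ ∫ y, ‖f y‖ := fun f x =>
      VectorFourier.norm_fourierIntegral_le_integral_norm _ _ _ _ _
    refine (integrable_inv_one_add_sq.const_mul ((∫ y, ‖g y‖) + ∫ y, ‖deriv (deriv g) y‖)).mono'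
      ?_ (.of_forall fun x => ?_)
    · exact (VectorFourier.fourierIntegral_continuous Real.continuous_fourierChar
        (by exact continuous_inner) h0).aestronglyMeasurable
    · rw [← div_eq_mul_inv, le_div_iff₀ (by positivity)]
      have k2 := hb (deriv (deriv g)) x
      rw [e2] at k2
      simp only [norm_smul, norm_mul, Complex.norm_I, Complex.norm_real, Complex.norm_ofNat,
        Real.norm_eq_abs, abs_of_pos pi_pos, mul_one] at k2
      have k0 := hb g x
      have : 1 ≤ 2 * π := by linarith [pi_gt_three]
      have k3 : x ^ 2 * ‖𝓕 g x‖ ≤ 2 * π * |x| * (2 * π * |x| * ‖𝓕 g x‖) := by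
        rw [← sq_abs x]
        have : 0 ≤ |x| ^ 2 * ‖𝓕 g x‖ := by positivity
        nlinarith [mul_le_mul_of_nonneg_right (one_le_mul_of_one_le_of_one_le ‹_› ‹1 ≤ 2 * π›) this]
      nlinarith
  have := hF.comp_div (R := 2 * π) (by positivity)
  rwa [funext (ft_eq_fourier g)]

theorem ft_mult {N s : ℝ} {m : ℝ → ℝ} (hm : AdmissibleLow N s m) (hN : 2 ≤ N) (f : 𝓢(ℝ, ℂ))
    (ξ : ℝ) : ft (mult m f) ξ = m ξ * ft f ξ := by
  obtain ⟨ψ, hψ⟩ := exists_schwartz_ft f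
  set M : ℝ → ℂ := fun ξ => (m ξ : ℂ) with hM
  set g : ℝ → ℂ := fun ξ => M ξ * ψ ξ with hg
  have hm2 : ContDiff ℝ 2 m := contDiff_infty.1 hm.smooth 2
  have hMs : ContDiff ℝ 2 M := Complex.ofRealCLM.contDiff.comp hm2
  have hm1 : ContDiff ℝ 1 (deriv m) := ((contDiff_succ_iff_deriv (n := 1)).1 hm2).2.2
  have hm0 : Continuous (deriv (deriv m)) :=
    ((contDiff_succ_iff_deriv (n := 0)).1 hm1).2.2.continuous
  have hM1 : ∀ x, HasDerivAt M ((deriv m x : ℝ) : ℂ) x := fun x =>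
    ((hm2.differentiable (by norm_num) x).hasDerivAt).ofReal_comp
  have hM2 : ∀ x, HasDerivAt (fun x => ((deriv m x : ℝ) : ℂ))
      ((deriv (deriv m) x : ℝ) : ℂ) x := fun x =>
    ((hm1.differentiable (by norm_num) x).hasDerivAt).ofReal_comp
  set ψ1 := SchwartzMap.derivCLM ℝ ℂ ψ with hψ1
  set ψ2 := SchwartzMap.derivCLM ℝ ℂ ψ1 with hψ2
  have d1 : ∀ x, HasDerivAt ψ (ψ1 x) x := fun x => (ψ.differentiableAt).hasDerivAt
  have d2 : ∀ x, HasDerivAt ψ1 (ψ2 x) x := fun x => (ψ1.differentiableAt).hasDerivAt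
  have D1 : deriv g = fun x => ((deriv m x : ℝ) : ℂ) * ψ x + M x * ψ1 x :=
    funext fun x => ((hM1 x).mul (d1 x)).deriv
  have D2 : deriv (deriv g) = fun x =>
      (((deriv (deriv m) x : ℝ) : ℂ) * ψ x + ((deriv m x : ℝ) : ℂ) * ψ1 x)
      + (((deriv m x : ℝ) : ℂ) * ψ1 x + M x * ψ2 x) := by
    rw [D1]
    exact funext fun x => (((hM2 x).mul (d1 x)).add ((hM1 x).mul (d2 x))).deriv
  have key : ∀ (a : ℝ → ℝ) (φ : 𝓢(ℝ, ℂ)), Continuous a → (∀ x, |a x| ≤ 10) →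
      Integrable (fun x => (a x : ℂ) * φ x) := fun a φ ha hb =>
    φ.integrable.bdd_mul (by fun_prop) (.of_forall fun x => by simpa using hb x)
  have b0 : ∀ x, |m x| ≤ 10 := fun x => by
    rw [abs_of_pos (hm.pos hN x)]; linarith [hm.le_one hN x]
  have b1 := hm.abs_deriv_le hN
  have b2 := hm.abs_deriv2_le hN
  have i0 : Integrable g := key m ψ hm.smooth.continuous b0
  have i1 : Integrable (deriv g) := by
    rw [D1]; exact (key _ ψ hm1.continuous b1).add (key _ ψ1 hm.smooth.continuous b0)
  have i2 : Integrable (deriv (deriv g)) := by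
    rw [D2]
    exact ((key _ ψ hm0 b2).add (key _ ψ1 hm1.continuous b1)).add
      ((key _ ψ1 hm1.continuous b1).add (key _ ψ2 hm.smooth.continuous b0))
  have hgs : ContDiff ℝ 2 g := hMs.mul (ψ.smooth 2)
  have hinv := ft_inversion hgs.continuous i0 (integrable_ft_of_contDiff hgs i0 i1 i2) ξ
  have hgξ : g ξ = m ξ * ft f ξ := by rw [hg, ← hψ]
  rw [← hgξ, hinv]
  have hmf : ∀ x, mult m f x = (2 * π : ℝ)⁻¹ • ft g (-x) := fun x => by
    unfold mult
    rw [ft]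
    congr 1
    refine integral_congr_ae (.of_forall fun η => ?_)
    simp only [hg, hM, ← hψ]
    rw [mul_assoc]
    congr 2
    push_cast
    ring
  unfold ft
  rw [← integral_neg_eq_self, ← integral_smul]
  refine integral_congr_ae (.of_forall fun x => ?_)
  simp only [hmf, neg_neg]
  rw [mul_smul_comm]
  congr 2
  congr 1
  push_cast
  ring

theorem stft_eq_ft_ft (u : ℝ → ℝ → ℂ) (ξ τ : ℝ) :
    stft u ξ τ = ft (fun t => ft (fun x => u x t) ξ) τ := by
  unfold stft ft
  refine integral_congr_ae (.of_forall fun t => ?_)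
  simp only [← integral_const_mul]
  refine integral_congr_ae (.of_forall fun x => ?_)
  simp only [← mul_assoc, ← Complex.exp_add]
  congr 2
  ring

theorem stft_multX {N s : ℝ} {m : ℝ → ℝ} (hm : AdmissibleLow N s m) (hN : 2 ≤ N)
    (g : 𝓢(ℝ × ℝ, ℂ)) (ξ τ : ℝ) :
    stft (multX m fun x t => g (x, t)) ξ τ = m ξ * stft (fun x t => g (x, t)) ξ τ := by
  rw [stft_eq_ft_ft, stft_eq_ft_ft]
  have : ∀ t, ft (fun x => multX m (fun x t => g (x, t)) x t) ξ =
      m ξ * ft (fun x => g (x, t)) ξ := fun t => by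
    obtain ⟨ψ, hψ⟩ := exists_schwartz_slice g t
    have h := ft_mult hm hN ψ ξ
    rwa [show (ψ : ℝ → ℂ) = fun x => g (x, t) from funext hψ] at h
  simp only [this]
  unfold ft
  rw [← integral_const_mul]
  refine integral_congr_ae (.of_forall fun t => ?_)
  ring

theorem SchwartzMap.exists_prod_decay (H : 𝓢(ℝ × ℝ, ℂ)) (k : ℕ) :
    ∃ D : ℝ, 0 ≤ D ∧ ∀ ξ τ, ‖H (ξ, τ)‖ * (jap ξ ^ k * jap τ ^ k) ≤ D := by
  set D := 2 ^ (2 * k) *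
    (Finset.Iic ((2 * k, 0) : ℕ × ℕ)).sup (fun m => SchwartzMap.seminorm ℝ m.1 m.2) H
  have h : ∀ p : ℝ × ℝ, (1 + ‖p‖) ^ (2 * k) * ‖H p‖ ≤ D := fun p => by
    simpa using SchwartzMap.one_add_le_sup_seminorm_apply (𝕜 := ℝ) (m := (2 * k, 0))
      (k := 2 * k) (n := 0) le_rfl le_rfl H p
  refine ⟨D, (by positivity : (0 : ℝ) ≤ _).trans (h 0), fun ξ τ => ?_⟩
  refine le_trans ?_ (h (ξ, τ))
  rw [mul_comm, ← mul_pow, pow_mul]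
  have h1 : |ξ| ≤ ‖(ξ, τ)‖ := norm_fst_le (ξ, τ)
  have h2 : |τ| ≤ ‖(ξ, τ)‖ := norm_snd_le (ξ, τ)
  have h3 : jap ξ * jap τ ≤ (1 + ‖(ξ, τ)‖) ^ 2 := by
    unfold jap
    rw [sq]
    gcongr
  gcongr
  exact mul_nonneg (jap_pos _).le (jap_pos _).le

theorem one_add_sq_le_jap_sq (ξ : ℝ) : 1 + ξ ^ 2 ≤ jap ξ ^ 2 := by
  unfold jap
  nlinarith [abs_nonneg ξ, sq_abs ξ]

theorem SchwartzMap.exists_sq_decay (H : 𝓢(ℝ × ℝ, ℂ)) :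
    ∃ D : ℝ, 0 ≤ D ∧ ∀ ξ τ, ‖H (ξ, τ)‖ ≤ D * ((1 + ξ ^ 2)⁻¹ * (1 + τ ^ 2)⁻¹) := by
  obtain ⟨D, hD, h⟩ := H.exists_prod_decay 2
  refine ⟨D, hD, fun ξ τ => ?_⟩
  rw [← mul_inv, ← div_eq_mul_inv, le_div_iff₀ (by positivity)]
  refine le_trans ?_ (h ξ τ)
  gcongr
  · exact one_add_sq_le_jap_sq ξ
  · exact one_add_sq_le_jap_sq τ

theorem ft_slice_inversion (g H : 𝓢(ℝ × ℝ, ℂ))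
    (hH : ∀ ξ τ, H (ξ, τ) = stft (fun x t => g (x, t)) ξ τ) (ξ t : ℝ) :
    ft (fun x => g (x, t)) ξ =
      (2 * π : ℝ)⁻¹ • ∫ τ : ℝ, Complex.exp (Complex.I * t * τ) * H (ξ, τ) := by
  obtain ⟨D, hD, hb⟩ := g.exists_sq_decay
  obtain ⟨D', hD', hb'⟩ := H.exists_sq_decay
  set v : ℝ → ℂ := fun t => ft (fun x => g (x, t)) ξ with hv
  have hft : ft v = fun τ => H (ξ, τ) := funext fun τ => by rw [hH, stft_eq_ft_ft]
  have hle : ∀ x t : ℝ, ‖Complex.exp (-Complex.I * x * ξ) * g (x, t)‖ = ‖g (x, t)‖ := fun x t => by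
    rw [norm_mul, Complex.norm_exp]; simp
  have hone : ∀ y : ℝ, (1 + y ^ 2)⁻¹ ≤ 1 := fun y => inv_le_one_of_one_le₀ (by nlinarith)
  have hvc : Continuous v := by
    refine continuous_of_dominated (bound := fun x => D * (1 + x ^ 2)⁻¹) (fun t => ?_) (fun t => ?_)
      (integrable_inv_one_add_sq.const_mul D) (.of_forall fun x => ?_)
    · exact Continuous.aestronglyMeasurable (by fun_prop)
    · refine .of_forall fun x => ?_
      rw [hle]
      refine (hb x t).trans ?_
      have := hone t
      have : 0 ≤ (1 + x ^ 2)⁻¹ := by positivity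
      gcongr
      nlinarith
    · fun_prop
  have hvi : Integrable v := by
    have : Integrable (fun p : ℝ × ℝ => Complex.exp (-Complex.I * p.1 * ξ) * g p)
        (volume.prod volume) := by
      refine ((g.integrable (μ := volume)).norm).mono' (by fun_prop) (.of_forall fun p => ?_)
      exact (hle p.1 p.2).le
    exact this.integral_prod_right
  have hHi : Integrable (ft v) := by
    rw [hft]
    refine (integrable_inv_one_add_sq.const_mul D').mono'
      (Continuous.aestronglyMeasurable (by fun_prop)) (.of_forall fun τ => ?_)
    refine (hb' ξ τ).trans ?_
    have := hone ξ
    have : 0 ≤ (1 + τ ^ 2)⁻¹ := by positivity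
    gcongr
    nlinarith
  have := ft_inversion hvc hvi hHi t
  rw [hft] at this
  exact this

/-- The squared `X^{1,1}` norm of `I u`, written as a lower Lebesgue integral. -/
theorem lintegral_le_XsbNorm_sq {N s : ℝ} {m : ℝ → ℝ} (hm : AdmissibleLow N s m) (hN : 2 ≤ N)
    (g H : 𝓢(ℝ × ℝ, ℂ)) (hH : ∀ ξ τ, H (ξ, τ) = stft (fun x t => g (x, t)) ξ τ) :
    ∫⁻ ξ : ℝ, ∫⁻ τ : ℝ, ENNReal.ofReal ((m ξ * jap ξ * jap (τ - ξ ^ 2) * ‖H (ξ, τ)‖) ^ 2) ≤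
      ENNReal.ofReal (XsbNorm 1 (1 / 2 + 1 / 2) (multX m fun x t => g (x, t))) ^ 2 := by
  set F : ℝ × ℝ → ℝ := fun p => (m p.1 * jap p.1 * jap (p.2 - p.1 ^ 2) * ‖H p‖) ^ 2 with hF
  have hmc := hm.smooth.continuous
  have hj := continuous_jap
  have hFc : Continuous F := by fun_prop
  have hF0 : ∀ p, 0 ≤ F p := fun p => by positivity
  obtain ⟨D, hD, hb⟩ := H.exists_prod_decay 4
  have hFi : Integrable F (volume.prod volume) := by
    refine ((integrable_inv_one_add_sq.mul_prod integrable_inv_one_add_sq).const_mul (D ^ 2)).mono'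
      hFc.aestronglyMeasurable (.of_forall fun p => ?_)
    obtain ⟨ξ, τ⟩ := p
    rw [Real.norm_of_nonneg (hF0 _), ← mul_inv, ← div_eq_mul_inv, le_div_iff₀ (by positivity)]
    have hx := one_le_jap ξ
    have ht := one_le_jap τ
    have h1 : jap (τ - ξ ^ 2) ≤ jap τ * jap ξ ^ 2 := by
      unfold jap
      have := abs_sub τ (ξ ^ 2)
      rw [abs_of_nonneg (sq_nonneg ξ)] at this
      nlinarith [abs_nonneg ξ, abs_nonneg τ, sq_abs ξ,
        mul_nonneg (abs_nonneg τ) (abs_nonneg ξ), mul_nonneg (abs_nonneg τ) (sq_nonneg ξ)]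
    have h2 : m ξ * jap ξ * jap (τ - ξ ^ 2) * ‖H (ξ, τ)‖ * (jap ξ * jap τ) ≤ D := by
      calc _ ≤ 1 * jap ξ * (jap τ * jap ξ ^ 2) * ‖H (ξ, τ)‖ * (jap ξ * jap τ) := by
            have := hm.le_one hN ξ
            have := (jap_pos (τ - ξ ^ 2)).le
            gcongr
        _ = ‖H (ξ, τ)‖ * (jap ξ ^ 4 * jap τ ^ 2) := by ring
        _ ≤ ‖H (ξ, τ)‖ * (jap ξ ^ 4 * jap τ ^ 4) := by gcongr; norm_num
        _ ≤ D := hb ξ τ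
    calc F (ξ, τ) * ((1 + ξ ^ 2) * (1 + τ ^ 2)) ≤ F (ξ, τ) * (jap ξ ^ 2 * jap τ ^ 2) := by
          have := hF0 (ξ, τ)
          gcongr
          · exact one_add_sq_le_jap_sq ξ
          · exact one_add_sq_le_jap_sq τ
      _ = (m ξ * jap ξ * jap (τ - ξ ^ 2) * ‖H (ξ, τ)‖ * (jap ξ * jap τ)) ^ 2 := by
          simp only [hF]; ring
      _ ≤ D ^ 2 := by
          have := (hm.pos hN ξ).le
          have := (jap_pos (τ - ξ ^ 2)).le
          gcongr
  have hX : XsbNorm 1 (1 / 2 + 1 / 2) (multX m fun x t => g (x, t)) =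
      (∫ p, F p ∂(volume.prod volume)) ^ ((1 : ℝ) / 2) := by
    rw [integral_prod _ hFi]
    unfold XsbNorm
    congr 1
    refine integral_congr_ae (.of_forall fun ξ => integral_congr_ae (.of_forall fun τ => ?_))
    simp only [stft_multX hm hN, ← hH, hF, norm_mul, Complex.norm_real, Real.norm_eq_abs,
      abs_of_pos (hm.pos hN ξ)]
    norm_num
    ring
  have hI0 : 0 ≤ ∫ p, F p ∂(volume.prod volume) := integral_nonneg hF0
  rw [hX, ← ENNReal.ofReal_pow (by positivity), ← Real.rpow_natCast, ← Real.rpow_mul hI0]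
  norm_num
  rw [ofReal_integral_eq_lintegral_ofReal hFi (.of_forall hF0), lintegral_prod _ (by fun_prop)]

/-- The `L²` norm of a nonnegative function. -/
def l2 (f : ℝ → ℝ≥0∞) : ℝ≥0∞ := (∫⁻ x, f x ^ 2) ^ (1 / 2 : ℝ)

theorem lintegral_mul_le_sqrt {α : Type*} [MeasurableSpace α] (μ : Measure α) {f g : α → ℝ≥0∞}
    (hf : AEMeasurable f μ) (hg : AEMeasurable g μ) :
    ∫⁻ a, f a * g a ∂μ ≤
      (∫⁻ a, f a ^ 2 ∂μ) ^ (1 / 2 : ℝ) * (∫⁻ a, g a ^ 2 ∂μ) ^ (1 / 2 : ℝ) := by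
  have := ENNReal.lintegral_mul_le_Lp_mul_Lq μ Real.HolderConjugate.two_two hf hg
  simpa using this

theorem sq_sqrt_ennreal (a : ℝ≥0∞) : (a ^ (1 / 2 : ℝ)) ^ 2 = a := by
  rw [← ENNReal.rpow_natCast, ← ENNReal.rpow_mul]; norm_num

theorem sqrt_sq_ennreal (a : ℝ≥0∞) : (a ^ 2) ^ (1 / 2 : ℝ) = a := by
  rw [← ENNReal.rpow_natCast, ← ENNReal.rpow_mul]; norm_num

theorem lintegral_inv_one_add_sq :
    ∫⁻ x : ℝ, ENNReal.ofReal ((1 + x ^ 2)⁻¹) = ENNReal.ofReal π := by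
  rw [← integral_univ_inv_one_add_sq, ofReal_integral_eq_lintegral_ofReal
    integrable_inv_one_add_sq (.of_forall fun x => by positivity)]

/-- `U` is the superposition of modulated free waves `e^{itς(ξ² + σ)}` with amplitudes
`b(ξ, σ)`, whose total weighted mass is controlled by `X`. -/
structure IsFreeSuperposition (m : ℝ → ℝ) (U : ℝ → ℝ → ℂ) (ς X : ℝ) (b : ℝ → ℝ → ℂ) : Prop where
  cont : Continuous fun p : ℝ × ℝ => b p.1 p.2
  decay : ∃ D : ℝ, ∀ ξ, ∫⁻ σ, ‖b ξ σ‖ₑ ≤ ENNReal.ofReal (D * (1 + ξ ^ 2)⁻¹)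
  repr : ∀ ξ t, U ξ t = ∫ σ, Complex.exp (Complex.I * (t * (ς * (ξ ^ 2 + σ)) : ℝ)) * b ξ σ
  bound : ∫⁻ σ, l2 (fun ξ => ENNReal.ofReal (m ξ * jap ξ) * ‖b ξ σ‖ₑ) ≤ 4 * ENNReal.ofReal X

theorem IsFreeSuperposition.conj {N s : ℝ} {m : ℝ → ℝ} (hm : AdmissibleLow N s m)
    {f : ℝ → ℝ → ℂ} {X : ℝ} {b : ℝ → ℝ → ℂ}
    (h : IsFreeSuperposition m (fun ξ t => ft (fun x => f x t) ξ) 1 X b) :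
    IsFreeSuperposition m (fun ξ t => ft (cj fun x => f x t) ξ) (-1) X
      (fun ξ σ => (starRingEnd ℂ) (b (-ξ) σ)) where
  cont := by
    have := h.cont.comp (f := fun p : ℝ × ℝ => (-p.1, p.2)) (by fun_prop)
    exact Complex.continuous_conj.comp this
  decay := by
    obtain ⟨D, hD⟩ := h.decay
    exact ⟨D, fun ξ => by simpa using hD (-ξ)⟩
  repr := fun ξ t => by
    have h1 : ft (cj fun x => f x t) ξ = (starRingEnd ℂ) (ft (fun x => f x t) (-ξ)) := by
      unfold ft cj
      rw [← integral_conj]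
      refine integral_congr_ae (.of_forall fun x => ?_)
      simp only [map_mul, ← Complex.exp_conj]
      simp
    rw [h1]
    have h2 := h.repr (-ξ) t
    rw [h2, ← integral_conj]
    refine integral_congr_ae (.of_forall fun σ => ?_)
    simp only [map_mul, ← Complex.exp_conj]
    congr 2
    simp
    ring
  bound := by
    refine le_of_eq_of_le (lintegral_congr fun σ => ?_) h.bound
    unfold l2
    rw [← lintegral_neg_eq_self]
    simp [hm.even, jap]

theorem exists_isFreeSuperposition {N s : ℝ} {m : ℝ → ℝ} (hm : AdmissibleLow N s m) (hN : 2 ≤ N)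
    {u : ℝ → ℝ → ℂ} (hu : IsSchwartz2 u) :
    ∃ b, IsFreeSuperposition m (fun ξ t => ft (fun x => u x t) ξ) 1
      (XsbNorm 1 (1 / 2 + 1 / 2) (multX m u)) b := by
  obtain ⟨g, hg⟩ := hu
  obtain rfl : u = fun x t => g (x, t) := funext fun x => funext fun t => hg x t
  clear hg
  obtain ⟨H, hH⟩ := exists_schwartz_stft g
  have hmc := hm.smooth.continuous
  have hj := continuous_jap
  have hc0 : 0 ≤ (2 * π)⁻¹ := by positivity
  have hc1 : (2 * π)⁻¹ ≤ 1 := inv_le_one_of_one_le₀ (by linarith [pi_gt_three])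
  have hb_le : ∀ ξ σ, ‖(2 * π : ℝ)⁻¹ • H (ξ, σ + ξ ^ 2)‖ ≤ ‖H (ξ, σ + ξ ^ 2)‖ := fun ξ σ => by
    rw [norm_smul, Real.norm_of_nonneg hc0]
    exact mul_le_of_le_one_left (norm_nonneg _) hc1
  refine ⟨fun ξ σ => (2 * π : ℝ)⁻¹ • H (ξ, σ + ξ ^ 2), by fun_prop, ?_, fun ξ t => ?_, ?_⟩
  · obtain ⟨D, hD, hb⟩ := H.exists_sq_decay
    refine ⟨D * π, fun ξ => ?_⟩
    calc ∫⁻ σ, ‖(2 * π : ℝ)⁻¹ • H (ξ, σ + ξ ^ 2)‖ₑ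
        ≤ ∫⁻ σ, ENNReal.ofReal (D * (1 + ξ ^ 2)⁻¹) * ENNReal.ofReal ((1 + (σ + ξ ^ 2) ^ 2)⁻¹) := by
          refine lintegral_mono fun σ => ?_
          rw [← ofReal_norm, ← ENNReal.ofReal_mul (by positivity), mul_assoc]
          exact ENNReal.ofReal_le_ofReal ((hb_le ξ σ).trans (hb _ _))
      _ = ENNReal.ofReal (D * π * (1 + ξ ^ 2)⁻¹) := by
          rw [lintegral_const_mul _ (by fun_prop), lintegral_add_right_eq_self
            (fun σ : ℝ => ENNReal.ofReal ((1 + σ ^ 2)⁻¹)), lintegral_inv_one_add_sq,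
            ← ENNReal.ofReal_mul (by positivity)]
          congr 1; ring
  · simp only
    rw [ft_slice_inversion g H hH, ← integral_add_right_eq_self _ (ξ ^ 2), ← integral_smul]
    refine integral_congr_ae (.of_forall fun σ => ?_)
    simp only [mul_smul_comm]
    congr 3
    push_cast
    ring
  · set B : ℝ → ℝ → ℝ≥0∞ := fun σ ξ =>
      ENNReal.ofReal (m ξ * jap ξ) * ‖(2 * π : ℝ)⁻¹ • H (ξ, σ + ξ ^ 2)‖ₑ with hB
    have hBm : Measurable (Function.uncurry B) := by
      refine Measurable.mul (Measurable.ennreal_ofReal ?_) (Continuous.measurable ?_).enorm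
      · exact Continuous.measurable (by fun_prop)
      · fun_prop
    have hGm : Measurable fun σ => ∫⁻ ξ, B σ ξ ^ 2 :=
      Measurable.lintegral_prod_right' (hBm.pow_const 2)
    calc ∫⁻ σ, l2 (B σ)
        = ∫⁻ σ, ENNReal.ofReal ((jap σ)⁻¹) * (ENNReal.ofReal (jap σ) * l2 (B σ)) := by
          refine lintegral_congr fun σ => ?_
          rw [← mul_assoc, ← ENNReal.ofReal_mul (inv_nonneg.2 (jap_pos σ).le),
            inv_mul_cancel₀ (jap_pos σ).ne']
          simp
      _ ≤ (∫⁻ σ, ENNReal.ofReal ((jap σ)⁻¹) ^ 2) ^ (1 / 2 : ℝ) *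
          (∫⁻ σ, (ENNReal.ofReal (jap σ) * l2 (B σ)) ^ 2) ^ (1 / 2 : ℝ) := by
          refine lintegral_mul_le_sqrt _ ?_ ?_
          · exact (hj.measurable.inv.ennreal_ofReal).aemeasurable
          · exact (hj.measurable.ennreal_ofReal.mul (hGm.pow_const _)).aemeasurable
      _ ≤ 4 * ENNReal.ofReal (XsbNorm 1 (1 / 2 + 1 / 2) (multX m fun x t => g (x, t))) := by
          gcongr
          · calc (∫⁻ σ, ENNReal.ofReal ((jap σ)⁻¹) ^ 2) ^ (1 / 2 : ℝ)
                ≤ (∫⁻ σ : ℝ, ENNReal.ofReal ((1 + σ ^ 2)⁻¹)) ^ (1 / 2 : ℝ) := by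
                  gcongr with σ
                  rw [← ENNReal.ofReal_pow (inv_nonneg.2 (jap_pos σ).le), inv_pow]
                  gcongr
                  exact one_add_sq_le_jap_sq σ
              _ ≤ (4 ^ 2) ^ (1 / 2 : ℝ) := by
                  rw [lintegral_inv_one_add_sq]
                  gcongr
                  rw [show (4 : ℝ≥0∞) ^ 2 = ENNReal.ofReal 16 by norm_num]
                  exact ENNReal.ofReal_le_ofReal (by linarith [pi_le_four])
              _ = 4 := sqrt_sq_ennreal 4
          · rw [← sqrt_sq_ennreal (ENNReal.ofReal _)]
            gcongr
            refine le_trans ?_ (lintegral_le_XsbNorm_sq hm hN g H hH)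
            calc ∫⁻ σ, (ENNReal.ofReal (jap σ) * l2 (B σ)) ^ 2
                = ∫⁻ σ, ∫⁻ ξ, (ENNReal.ofReal (jap σ) * B σ ξ) ^ 2 := by
                  refine lintegral_congr fun σ => ?_
                  simp only [mul_pow, l2, sq_sqrt_ennreal]
                  rw [lintegral_const_mul']
                  exact ENNReal.pow_ne_top ENNReal.ofReal_ne_top
              _ = ∫⁻ ξ, ∫⁻ σ, (ENNReal.ofReal (jap σ) * B σ ξ) ^ 2 := by
                  refine lintegral_lintegral_swap (Measurable.aemeasurable ?_)
                  exact ((hj.measurable.ennreal_ofReal.comp measurable_fst).mul hBm).pow_const 2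
              _ ≤ ∫⁻ ξ, ∫⁻ τ,
                  ENNReal.ofReal ((m ξ * jap ξ * jap (τ - ξ ^ 2) * ‖H (ξ, τ)‖) ^ 2) := by
                  refine lintegral_mono fun ξ => ?_
                  rw [← lintegral_add_right_eq_self (fun τ => ENNReal.ofReal
                    ((m ξ * jap ξ * jap (τ - ξ ^ 2) * ‖H (ξ, τ)‖) ^ 2)) (ξ ^ 2)]
                  refine lintegral_mono fun σ => ?_
                  have h1 := hm.pos hN ξ
                  have h2 := jap_pos ξ
                  have h3 := jap_pos σ
                  simp only [hB, add_sub_cancel_right]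
                  rw [← ofReal_norm, ← ENNReal.ofReal_mul (by positivity),
                    ← ENNReal.ofReal_mul (by positivity), ← ENNReal.ofReal_pow (by positivity)]
                  refine ENNReal.ofReal_le_ofReal ?_
                  have := hb_le ξ σ
                  rw [← mul_assoc, mul_comm (jap σ)]
                  gcongr

/-- The size of the time integral of an oscillation of frequency `y`, up to a constant. -/
def resonance (y : ℝ) : ℝ≥0∞ := ENNReal.ofReal ((1 + |y|)⁻¹)

theorem resonance_neg (y : ℝ) : resonance (-y) = resonance y := by simp [resonance]

@[fun_prop]
theorem measurable_resonance : Measurable resonance := by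
  unfold resonance
  have : Continuous fun y : ℝ => (1 + |y|)⁻¹ :=
    Continuous.inv₀ (by fun_prop) fun y => by positivity
  exact this.measurable.ennreal_ofReal

theorem resonance_sq_le (A r : ℝ) :
    resonance (A + 2 * r ^ 2) ^ 2 ≤
      ENNReal.ofReal ((1 + (r + √(-A / 2)) ^ 2)⁻¹) +
        ENNReal.ofReal ((1 + (r - √(-A / 2)) ^ 2)⁻¹) := by
  unfold resonance
  rw [← ENNReal.ofReal_pow (by positivity), ← ENNReal.ofReal_add (by positivity) (by positivity)]
  refine ENNReal.ofReal_le_ofReal ?_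
  set B := √(-A / 2) with hB
  have hB0 : 0 ≤ B := sqrt_nonneg _
  have h1 : (1 + |A + 2 * r ^ 2|)⁻¹ ^ 2 ≤ (1 + |A + 2 * r ^ 2|)⁻¹ := by
    have h0 : (1 + |A + 2 * r ^ 2|)⁻¹ ≤ 1 :=
      inv_le_one_of_one_le₀ (by linarith [abs_nonneg (A + 2 * r ^ 2)])
    exact pow_le_of_le_one (by positivity) h0 two_ne_zero
  have h2 : (|r| - B) ^ 2 ≤ |A + 2 * r ^ 2| := by
    rcases le_total 0 A with hA | hA
    · have : B = 0 := sqrt_eq_zero_of_nonpos (by linarith)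
      rw [this, sub_zero, sq_abs, abs_of_nonneg (by positivity)]
      nlinarith [sq_nonneg r]
    · have hBB : A = -2 * B ^ 2 := by rw [hB, sq_sqrt (by linarith)]; ring
      have e : A + 2 * r ^ 2 = 2 * ((|r| - B) * (|r| + B)) := by
        rw [hBB]; nlinarith [sq_abs r]
      have hr := abs_nonneg r
      rw [e, abs_mul, abs_mul, abs_two, abs_of_nonneg (a := |r| + B) (by positivity),
        ← sq_abs (|r| - B)]
      have h3 : |(|r| - B)| ≤ |r| + B := abs_le.2 ⟨by linarith, by linarith⟩
      nlinarith [abs_nonneg (|r| - B)]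
  have h3 : (1 + |A + 2 * r ^ 2|)⁻¹ ≤ (1 + (|r| - B) ^ 2)⁻¹ := by gcongr
  refine h1.trans (h3.trans ?_)
  have h4 : 0 ≤ (1 + (r + B) ^ 2)⁻¹ := by positivity
  have h5 : 0 ≤ (1 + (r - B) ^ 2)⁻¹ := by positivity
  rcases le_total 0 r with hr | hr
  · rw [abs_of_nonneg hr]; linarith
  · rw [abs_of_nonpos hr, show (-r - B) ^ 2 = (r + B) ^ 2 by ring]; linarith

theorem lintegral_resonance_sq_le (A d : ℝ) :
    ∫⁻ r : ℝ, resonance (A + 2 * (r - d) ^ 2) ^ 2 ≤ 9 := by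
  rw [lintegral_sub_right_eq_self (fun r => resonance (A + 2 * r ^ 2) ^ 2)]
  refine (lintegral_mono (resonance_sq_le A)).trans ?_
  have h1 (B : ℝ) : ∫⁻ r : ℝ, ENNReal.ofReal ((1 + (r + B) ^ 2)⁻¹) = ENNReal.ofReal π := by
    rw [lintegral_add_right_eq_self (fun r : ℝ => ENNReal.ofReal ((1 + r ^ 2)⁻¹)),
      lintegral_inv_one_add_sq]
  rw [lintegral_add_left (by fun_prop), h1]
  simp only [sub_eq_add_neg]
  rw [h1, ← ENNReal.ofReal_add pi_nonneg pi_nonneg, show (9 : ℝ≥0∞) = ENNReal.ofReal 9 by norm_num]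
  exact ENNReal.ofReal_le_ofReal (by linarith [pi_lt_d2])

/-- The trilinear estimate behind `L⁶`-type Strichartz bounds: two frequencies entering the
phase with the same sign and one with the opposite sign. -/
theorem lintegral_resonance_trilinear_le {f g h : ℝ → ℝ≥0∞} (hf : Measurable f)
    (hg : Measurable g) (hh : Measurable h) (A c : ℝ) :
    ∫⁻ a, ∫⁻ b, resonance (A + a ^ 2 + b ^ 2 - (c - a - b) ^ 2) * (f a * g b * h (c - a - b)) ≤
      3 * (l2 f * l2 g * l2 h) := by
  have hK : Measurable fun p : ℝ × ℝ =>
      resonance (A + p.1 ^ 2 + p.2 ^ 2 - (c - p.1 - p.2) ^ 2) := by fun_prop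
  calc ∫⁻ a, ∫⁻ b, resonance (A + a ^ 2 + b ^ 2 - (c - a - b) ^ 2) * (f a * g b * h (c - a - b))
      = ∫⁻ p : ℝ × ℝ, (f p.1 * g p.2) *
          (resonance (A + p.1 ^ 2 + p.2 ^ 2 - (c - p.1 - p.2) ^ 2) * h (c - p.1 - p.2)) := by
        rw [Measure.volume_eq_prod, lintegral_prod _ (by fun_prop)]
        refine lintegral_congr fun a => lintegral_congr fun b => ?_
        ring
    _ ≤ (∫⁻ p : ℝ × ℝ, (f p.1 * g p.2) ^ 2) ^ (1 / 2 : ℝ) * (∫⁻ p : ℝ × ℝ,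
          (resonance (A + p.1 ^ 2 + p.2 ^ 2 - (c - p.1 - p.2) ^ 2) * h (c - p.1 - p.2)) ^ 2)
            ^ (1 / 2 : ℝ) := lintegral_mul_le_sqrt _ (by fun_prop) (by fun_prop)
    _ ≤ (l2 f * l2 g) * (3 * l2 h) := by
        gcongr
        · simp only [mul_pow, l2]
          rw [Measure.volume_eq_prod, lintegral_prod_mul (f := fun a => f a ^ 2)
            (g := fun a => g a ^ 2) (by fun_prop) (by fun_prop),
            ENNReal.mul_rpow_of_nonneg _ _ (by norm_num)]
        · have h3 : (3 : ℝ≥0∞) = (3 ^ 2) ^ (1 / 2 : ℝ) := (sqrt_sq_ennreal 3).symm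
          rw [h3, l2, ← ENNReal.mul_rpow_of_nonneg _ _ (by norm_num)]
          gcongr
          calc ∫⁻ p : ℝ × ℝ,
                (resonance (A + p.1 ^ 2 + p.2 ^ 2 - (c - p.1 - p.2) ^ 2) * h (c - p.1 - p.2)) ^ 2
              = ∫⁻ a, ∫⁻ b, (resonance (A + a ^ 2 + b ^ 2 - (c - a - b) ^ 2)
                  * h (c - a - b)) ^ 2 := by
                rw [Measure.volume_eq_prod, lintegral_prod _ (by fun_prop)]
            _ = ∫⁻ a, ∫⁻ d, (resonance (A + a ^ 2 + (c - a - d) ^ 2 - d ^ 2) * h d) ^ 2 := by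
                refine lintegral_congr fun a => ?_
                rw [← lintegral_sub_left_eq_self _ (c - a)]
                simp only [sub_sub_cancel]
            _ = ∫⁻ d, ∫⁻ a, (resonance (A + a ^ 2 + (c - a - d) ^ 2 - d ^ 2) * h d) ^ 2 :=
                lintegral_lintegral_swap (by fun_prop)
            _ ≤ ∫⁻ d, 9 * h d ^ 2 := by
                refine lintegral_mono fun d => ?_
                simp only [mul_pow]
                rw [lintegral_mul_const _ (by fun_prop)]
                gcongr
                refine le_of_eq_of_le (lintegral_congr fun a => ?_) (lintegral_resonance_sq_le
                  (A + (c - d) ^ 2 / 2 - d ^ 2) ((c - d) / 2))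
                congr 2
                ring
            _ = 3 ^ 2 * ∫⁻ d, h d ^ 2 := by
                rw [lintegral_const_mul _ (by fun_prop)]; norm_num
    _ = 3 * (l2 f * l2 g * l2 h) := by ring

theorem lintegral_resonance_trilinear_le' {f g h : ℝ → ℝ≥0∞} (hf : Measurable f)
    (hg : Measurable g) (hh : Measurable h) (A c : ℝ) :
    ∫⁻ a, ∫⁻ b, resonance (A - a ^ 2 + b ^ 2 - (c - a - b) ^ 2) * (f a * g b * h (c - a - b)) ≤
      3 * (l2 f * l2 g * l2 h) := by
  calc _ = ∫⁻ a, ∫⁻ b, resonance (-A + a ^ 2 + b ^ 2 - (c - a - b) ^ 2) *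
        (f a * h b * g (c - a - b)) := by
        refine lintegral_congr fun a => ?_
        rw [← lintegral_sub_left_eq_self _ (c - a)]
        refine lintegral_congr fun b => ?_
        rw [← resonance_neg]
        simp only [sub_sub_cancel]
        congr 1
        · congr 1; ring
        · ring
    _ ≤ _ := (lintegral_resonance_trilinear_le hf hh hg _ _).trans_eq (by ring)

section Hexalinear

variable {h₁ h₂ h₃ h₄ h₅ h₆ : ℝ → ℝ≥0∞}

theorem lintegral_resonance_hexalinear_le_right (m₁ : Measurable h₁) (m₂ : Measurable h₂)
    (m₃ : Measurable h₃) (m₄ : Measurable h₄) (m₅ : Measurable h₅) (m₆ : Measurable h₆) (A : ℝ) :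
    ∫⁻ p : ℝ × ℝ, ∫⁻ x : ℝ, ∫⁻ q : ℝ × ℝ,
      resonance (A + p.1 ^ 2 - p.2 ^ 2 + x ^ 2 - q.1 ^ 2 + q.2 ^ 2
          - (-(p.1 + p.2 + x + q.1 + q.2)) ^ 2) *
        (h₁ p.1 * h₂ p.2 * h₃ x * (h₄ q.1 * h₅ q.2 * h₆ (-(p.1 + p.2 + x + q.1 + q.2)))) ≤
      3 * (((∫⁻ ξ, h₁ ξ) * (∫⁻ ξ, h₂ ξ) * ∫⁻ ξ, h₃ ξ) * (l2 h₄ * l2 h₅ * l2 h₆)) := by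
  calc _ ≤ ∫⁻ p : ℝ × ℝ, ∫⁻ x : ℝ,
        h₁ p.1 * h₂ p.2 * h₃ x * (3 * (l2 h₄ * l2 h₅ * l2 h₆)) := by
        refine lintegral_mono fun p => lintegral_mono fun x => ?_
        refine le_of_eq_of_le ?_ (mul_le_mul_right (lintegral_resonance_trilinear_le' m₄ m₅ m₆
          (A + p.1 ^ 2 - p.2 ^ 2 + x ^ 2) (-(p.1 + p.2 + x))) (h₁ p.1 * h₂ p.2 * h₃ x))
        have e (a b : ℝ) : -(p.1 + p.2 + x + a + b) = -(p.1 + p.2 + x) - a - b := by ring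
        simp only [e]
        rw [← lintegral_const_mul _ (by fun_prop), Measure.volume_eq_prod,
          lintegral_prod _ (by fun_prop)]
        refine lintegral_congr fun a => ?_
        rw [← lintegral_const_mul _ (by fun_prop)]
        refine lintegral_congr fun b => ?_
        ring
    _ = ∫⁻ p : ℝ × ℝ, h₁ p.1 * h₂ p.2 *
        ((∫⁻ x, h₃ x) * (3 * (l2 h₄ * l2 h₅ * l2 h₆))) := by
        refine lintegral_congr fun p => ?_
        rw [lintegral_mul_const _ (by fun_prop), lintegral_const_mul _ (by fun_prop), mul_assoc]
    _ = _ := by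
        rw [lintegral_mul_const _ (by fun_prop), Measure.volume_eq_prod,
          lintegral_prod_mul (by fun_prop) (by fun_prop)]
        ring

theorem lintegral_hyperplane_rotate {F : (ℝ × ℝ) → ℝ → ℝ → (ℝ × ℝ) → ℝ≥0∞}
    (hF : Measurable fun z : (ℝ × ℝ) × ℝ × ℝ × (ℝ × ℝ) => F z.1 z.2.1 z.2.2.1 z.2.2.2) :
    ∫⁻ p : ℝ × ℝ, ∫⁻ x : ℝ, ∫⁻ q : ℝ × ℝ, F p x (-(p.1 + p.2 + x + q.1 + q.2)) q =
      ∫⁻ q : ℝ × ℝ, ∫⁻ y : ℝ, ∫⁻ p : ℝ × ℝ, F p (-(q.1 + q.2 + y + p.1 + p.2)) y q := by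
  have h1 : Measurable fun z : ((ℝ × ℝ) × (ℝ × ℝ)) × ℝ =>
      F z.1.1 z.2 (-(z.1.1.1 + z.1.1.2 + z.2 + z.1.2.1 + z.1.2.2)) z.1.2 :=
    hF.comp (by fun_prop : Measurable fun z : ((ℝ × ℝ) × (ℝ × ℝ)) × ℝ =>
      (z.1.1, z.2, -(z.1.1.1 + z.1.1.2 + z.2 + z.1.2.1 + z.1.2.2), z.1.2))
  have h2 : Measurable fun z : ((ℝ × ℝ) × (ℝ × ℝ)) × ℝ =>
      F z.1.1 (-(z.1.2.1 + z.1.2.2 + z.2 + z.1.1.1 + z.1.1.2)) z.2 z.1.2 :=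
    hF.comp (by fun_prop : Measurable fun z : ((ℝ × ℝ) × (ℝ × ℝ)) × ℝ =>
      (z.1.1, -(z.1.2.1 + z.1.2.2 + z.2 + z.1.1.1 + z.1.1.2), z.2, z.1.2))
  calc _ = ∫⁻ p : ℝ × ℝ, ∫⁻ q : ℝ × ℝ, ∫⁻ x : ℝ, F p x (-(p.1 + p.2 + x + q.1 + q.2)) q := by
        refine lintegral_congr fun p => lintegral_lintegral_swap (Measurable.aemeasurable ?_)
        exact h1.comp (by fun_prop : Measurable fun z : ℝ × (ℝ × ℝ) => ((p, z.2), z.1))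
    _ = ∫⁻ q : ℝ × ℝ, ∫⁻ p : ℝ × ℝ, ∫⁻ x : ℝ, F p x (-(p.1 + p.2 + x + q.1 + q.2)) q :=
        lintegral_lintegral_swap (Measurable.lintegral_prod_right' h1).aemeasurable
    _ = ∫⁻ q : ℝ × ℝ, ∫⁻ p : ℝ × ℝ, ∫⁻ y : ℝ, F p (-(q.1 + q.2 + y + p.1 + p.2)) y q := by
        refine lintegral_congr fun q => lintegral_congr fun p => ?_
        rw [← lintegral_sub_left_eq_self _ (-(p.1 + p.2 + q.1 + q.2))]
        refine lintegral_congr fun y => ?_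
        congr 1 <;> ring
    _ = _ := by
        refine lintegral_congr fun q => lintegral_lintegral_swap (Measurable.aemeasurable ?_)
        exact h2.comp (by fun_prop : Measurable fun z : (ℝ × ℝ) × ℝ => ((z.1, q), z.2))

theorem lintegral_resonance_hexalinear_le_left (m₁ : Measurable h₁) (m₂ : Measurable h₂)
    (m₃ : Measurable h₃) (m₄ : Measurable h₄) (m₅ : Measurable h₅) (m₆ : Measurable h₆) (A : ℝ) :
    ∫⁻ p : ℝ × ℝ, ∫⁻ x : ℝ, ∫⁻ q : ℝ × ℝ,
      resonance (A + p.1 ^ 2 - p.2 ^ 2 + x ^ 2 - q.1 ^ 2 + q.2 ^ 2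
          - (-(p.1 + p.2 + x + q.1 + q.2)) ^ 2) *
        (h₁ p.1 * h₂ p.2 * h₃ x * (h₄ q.1 * h₅ q.2 * h₆ (-(p.1 + p.2 + x + q.1 + q.2)))) ≤
      3 * ((l2 h₁ * l2 h₂ * l2 h₃) * ((∫⁻ ξ, h₄ ξ) * (∫⁻ ξ, h₅ ξ) * ∫⁻ ξ, h₆ ξ)) := by
  rw [lintegral_hyperplane_rotate (F := fun p x y q =>
    resonance (A + p.1 ^ 2 - p.2 ^ 2 + x ^ 2 - q.1 ^ 2 + q.2 ^ 2 - y ^ 2) *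
        (h₁ p.1 * h₂ p.2 * h₃ x * (h₄ q.1 * h₅ q.2 * h₆ y))) (by fun_prop)]
  refine le_of_eq_of_le ?_ ((lintegral_resonance_hexalinear_le_right m₄ m₅ m₆ m₁ m₂ m₃
    (-A)).trans_eq (by ring))
  refine lintegral_congr fun q => lintegral_congr fun y => lintegral_congr fun p => ?_
  rw [← resonance_neg]
  congr 1
  · congr 1; ring
  · ring

end Hexalinear

/-- A weight equal to `1` at low frequencies and of size `√N` at frequencies `≳ N`. -/
def highWeight (N ξ : ℝ) : ℝ := if N / 15 ≤ |ξ| then 1 + √N else 1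

theorem one_le_highWeight (N ξ : ℝ) : 1 ≤ highWeight N ξ := by
  unfold highWeight
  split_ifs
  · linarith [sqrt_nonneg N]
  · exact le_rfl

@[fun_prop]
theorem measurable_highWeight (N : ℝ) : Measurable (highWeight N) := by
  unfold highWeight
  refine Measurable.ite ?_ measurable_const measurable_const
  exact (isClosed_le continuous_const continuous_abs).measurableSet

theorem le_prod_highWeight {N : ℝ} (hN : 0 ≤ N) {ξ : Fin 6 → ℝ} (h0 : ∑ i, ξ i = 0) {j : Fin 6}
    (hj : N / 3 < |ξ j|) : N ≤ ∏ i, highWeight N (ξ i) := by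
  obtain ⟨k, hkj, hk⟩ : ∃ k, k ≠ j ∧ N / 15 ≤ |ξ k| := by
    by_contra! hc
    have h1 : ξ j = -∑ i ∈ Finset.univ.erase j, ξ i := by
      rw [← Finset.add_sum_erase _ _ (Finset.mem_univ j)] at h0
      linarith
    have h2 : |ξ j| ≤ ∑ i ∈ Finset.univ.erase j, N / 15 := by
      rw [h1, abs_neg]
      refine (Finset.abs_sum_le_sum_abs _ _).trans (Finset.sum_le_sum fun i hi => ?_)
      exact (hc i (Finset.ne_of_mem_erase hi)).le
    rw [Finset.sum_const, Finset.card_erase_of_mem (Finset.mem_univ j)] at h2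
    simp at h2
    linarith
  have hs (i) (h : N / 15 ≤ |ξ i|) : √N ≤ highWeight N (ξ i) := by
    rw [highWeight, if_pos h]; linarith
  have h1 : 1 ≤ ∏ i ∈ (Finset.univ.erase j).erase k, highWeight N (ξ i) :=
    Finset.prod_induction _ (fun x => 1 ≤ x) (fun a b ha hb => one_le_mul_of_one_le_of_one_le ha hb)
      le_rfl fun i _ => one_le_highWeight N (ξ i)
  rw [← Finset.mul_prod_erase _ _ (Finset.mem_univ j),
    ← Finset.mul_prod_erase _ _ (Finset.mem_erase.2 ⟨hkj, Finset.mem_univ k⟩)]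
  calc N = √N * (√N * 1) := by rw [mul_one, mul_self_sqrt hN]
    _ ≤ _ := by
      gcongr
      · linarith [one_le_highWeight N (ξ j)]
      · exact hs j (by linarith)
      · linarith [one_le_highWeight N (ξ k)]
      · exact hs k hk

theorem AdmissibleLow.abs_symbol_le {N s : ℝ} {m : ℝ → ℝ} (hm : AdmissibleLow N s m) (hN : 2 ≤ N)
    {ξ₁ ξ₂ ξ₃ ξ₄ ξ₅ ξ₆ : ℝ} (h0 : ξ₁ + ξ₂ + ξ₃ + ξ₄ + ξ₅ + ξ₆ = 0) :
    |m (ξ₁ + ξ₂ + ξ₃) * m ξ₄ * m ξ₅ * m ξ₆ - m ξ₁ * m ξ₂ * m ξ₃ * m (ξ₄ + ξ₅ + ξ₆)| ≤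
      N⁻¹ * (highWeight N ξ₁ * highWeight N ξ₂ * highWeight N ξ₃ *
        (highWeight N ξ₄ * highWeight N ξ₅ * highWeight N ξ₆)) *
        (m ξ₄ * m ξ₅ * m ξ₆ + m ξ₁ * m ξ₂ * m ξ₃) := by
  have hp := hm.pos hN
  have hw (ξ) : 0 < highWeight N ξ := lt_of_lt_of_le one_pos (one_le_highWeight N ξ)
  have := hp ξ₁; have := hp ξ₂; have := hp ξ₃; have := hp ξ₄; have := hp ξ₅; have := hp ξ₆
  have := hw ξ₁; have := hw ξ₂; have := hw ξ₃; have := hw ξ₄; have := hw ξ₅; have := hw ξ₆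
  have hN0 : 0 < N := by linarith
  by_cases hc : ∀ i, |![ξ₁, ξ₂, ξ₃, ξ₄, ξ₅, ξ₆] i| ≤ N / 3
  · have h1 : |ξ₁| ≤ N / 3 := hc 0
    have h2 : |ξ₂| ≤ N / 3 := hc 1
    have h3 : |ξ₃| ≤ N / 3 := hc 2
    have h4 : |ξ₄| ≤ N / 3 := hc 3
    have h5 : |ξ₅| ≤ N / 3 := hc 4
    have h6 : |ξ₆| ≤ N / 3 := hc 5
    have e1 : m (ξ₁ + ξ₂ + ξ₃) = 1 :=
      hm.eq_one _ ((abs_add_three _ _ _).trans (by linarith))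
    have e2 : m (ξ₄ + ξ₅ + ξ₆) = 1 :=
      hm.eq_one _ ((abs_add_three _ _ _).trans (by linarith))
    rw [e1, e2, hm.eq_one _ (h1.trans (by linarith)), hm.eq_one _ (h2.trans (by linarith)),
      hm.eq_one _ (h3.trans (by linarith)), hm.eq_one _ (h4.trans (by linarith)),
      hm.eq_one _ (h5.trans (by linarith)), hm.eq_one _ (h6.trans (by linarith))]
    norm_num
    positivity
  · push Not at hc
    obtain ⟨j, hj⟩ := hc
    have hW := le_prod_highWeight hN0.le (by rw [Fin.sum_univ_six]; exact h0) hj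
    rw [Fin.prod_univ_six] at hW
    have hW' : N ≤ highWeight N ξ₁ * highWeight N ξ₂ * highWeight N ξ₃ *
        (highWeight N ξ₄ * highWeight N ξ₅ * highWeight N ξ₆) := hW.trans_eq (by simp; ring)
    have h1 : 1 ≤ N⁻¹ * (highWeight N ξ₁ * highWeight N ξ₂ * highWeight N ξ₃ *
        (highWeight N ξ₄ * highWeight N ξ₅ * highWeight N ξ₆)) := by
      rw [inv_mul_eq_div, one_le_div hN0]; exact hW'
    have ha := hp (ξ₁ + ξ₂ + ξ₃)
    have hb := hp (ξ₄ + ξ₅ + ξ₆)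
    have ha1 := hm.le_one hN (ξ₁ + ξ₂ + ξ₃)
    have hb1 := hm.le_one hN (ξ₄ + ξ₅ + ξ₆)
    have hP : 0 < m ξ₄ * m ξ₅ * m ξ₆ := by positivity
    have hQ : 0 < m ξ₁ * m ξ₂ * m ξ₃ := by positivity
    refine le_trans ?_ (le_mul_of_one_le_left (by positivity) h1)
    rw [show m (ξ₁ + ξ₂ + ξ₃) * m ξ₄ * m ξ₅ * m ξ₆ =
      m (ξ₁ + ξ₂ + ξ₃) * (m ξ₄ * m ξ₅ * m ξ₆) by ring]
    refine abs_le.2 ⟨?_, ?_⟩ <;> nlinarith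

theorem AdmissibleLow.highWeight_le {N s : ℝ} {m : ℝ → ℝ} (hm : AdmissibleLow N s m) (hN : 2 ≤ N)
    (ξ : ℝ) : highWeight N ξ ≤ 16 * (m ξ * jap ξ) := by
  have h1 := hm.one_le_mul_jap hN ξ
  unfold highWeight
  split_ifs with h
  · have h2 := hm.div_le_mul_jap hN h
    have h3 : √N ≤ N := sqrt_le_iff.2 ⟨by linarith, by nlinarith⟩
    linarith
  · linarith

theorem lintegral_inv_one_add_div_sq {a : ℝ} (ha : 0 < a) :
    ∫⁻ ξ : ℝ, ENNReal.ofReal (a⁻¹ * (1 + (ξ / a) ^ 2)⁻¹) = ENNReal.ofReal π := by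
  rw [← ofReal_integral_eq_lintegral_ofReal]
  · rw [integral_const_mul, Measure.integral_comp_div (fun x : ℝ => (1 + x ^ 2)⁻¹),
      integral_univ_inv_one_add_sq, abs_of_pos ha, smul_eq_mul, inv_mul_cancel_left₀ ha.ne']
  · exact (integrable_inv_one_add_sq.comp_div ha.ne').const_mul _
  · exact .of_forall fun ξ => by positivity

theorem highWeight_div_jap_sq_le {N : ℝ} (hN : 0 < N) (ξ : ℝ) :
    (highWeight N ξ / jap ξ) ^ 2 ≤
      2 * (1 + ξ ^ 2)⁻¹ + 60 * ((N / 15)⁻¹ * (1 + (ξ / (N / 15)) ^ 2)⁻¹) := by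
  have hj := one_add_sq_le_jap_sq ξ
  have h1 : (jap ξ ^ 2)⁻¹ ≤ (1 + ξ ^ 2)⁻¹ := by gcongr
  have h2 : 0 ≤ (jap ξ ^ 2)⁻¹ := by positivity
  have hz : 0 ≤ (N / 15)⁻¹ * (1 + (ξ / (N / 15)) ^ 2)⁻¹ := by positivity
  rw [div_pow, div_eq_mul_inv]
  unfold highWeight
  split_ifs with h
  · have h3 : (1 + √N) ^ 2 ≤ 2 + 2 * N := by
      nlinarith [sq_sqrt hN.le, sq_nonneg (1 - √N)]
    have h4 : N * (jap ξ ^ 2)⁻¹ ≤ 30 * ((N / 15)⁻¹ * (1 + (ξ / (N / 15)) ^ 2)⁻¹) := by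
      obtain ⟨a, rfl⟩ : ∃ a, N = 15 * a := ⟨N / 15, by ring⟩
      rw [mul_div_cancel_left₀ a (by norm_num : (15 : ℝ) ≠ 0)] at h ⊢
      have ha0 : 0 < a := by linarith
      have h5 : a ^ 2 ≤ ξ ^ 2 := (pow_le_pow_left₀ ha0.le h 2).trans_eq (sq_abs ξ)
      have e : a⁻¹ * (1 + (ξ / a) ^ 2)⁻¹ = a / (a ^ 2 + ξ ^ 2) := by field_simp
      rw [e, ← div_eq_mul_inv, mul_div_assoc', div_le_div_iff₀ (by nlinarith) (by positivity)]
      nlinarith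
    calc (1 + √N) ^ 2 * (jap ξ ^ 2)⁻¹ ≤ (2 + 2 * N) * (jap ξ ^ 2)⁻¹ := by gcongr
      _ ≤ _ := by nlinarith
  · linarith

theorem lintegral_highWeight_div_jap_sq_le {N : ℝ} (hN : 0 < N) :
    ∫⁻ ξ, ENNReal.ofReal (highWeight N ξ / jap ξ) ^ 2 ≤ 16 ^ 2 := by
  have h0 (ξ) : 0 ≤ highWeight N ξ / jap ξ :=
    div_nonneg (by linarith [one_le_highWeight N ξ]) (jap_pos ξ).le
  have hm : Measurable fun ξ : ℝ => 60 * ((N / 15)⁻¹ * (1 + (ξ / (N / 15)) ^ 2)⁻¹) := by fun_prop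
  calc _ ≤ ∫⁻ ξ, (ENNReal.ofReal 2 * ENNReal.ofReal ((1 + ξ ^ 2)⁻¹) +
        ENNReal.ofReal 60 * ENNReal.ofReal ((N / 15)⁻¹ * (1 + (ξ / (N / 15)) ^ 2)⁻¹)) := by
        refine lintegral_mono fun ξ => ?_
        rw [← ENNReal.ofReal_pow (h0 ξ), ← ENNReal.ofReal_mul (by norm_num),
          ← ENNReal.ofReal_mul (by norm_num), ← ENNReal.ofReal_add (by positivity) (by positivity)]
        exact ENNReal.ofReal_le_ofReal (highWeight_div_jap_sq_le hN ξ)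
    _ = ENNReal.ofReal (2 * π + 60 * π) := by
        rw [lintegral_add_left (by fun_prop), lintegral_const_mul _ (by fun_prop),
          lintegral_const_mul _ (by fun_prop), lintegral_inv_one_add_sq,
          lintegral_inv_one_add_div_sq (by positivity), ← ENNReal.ofReal_mul (by norm_num),
          ← ENNReal.ofReal_mul (by norm_num), ← ENNReal.ofReal_add (by positivity) (by positivity)]
    _ ≤ 16 ^ 2 := by
        rw [show (16 : ℝ≥0∞) ^ 2 = ENNReal.ofReal 256 by norm_num]
        exact ENNReal.ofReal_le_ofReal (by linarith [pi_lt_d2])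

theorem l2_mono {f g : ℝ → ℝ≥0∞} (h : ∀ x, f x ≤ g x) : l2 f ≤ l2 g := by
  unfold l2
  gcongr with x
  exact h x

theorem l2_const_mul (c : ℝ≥0∞) {f : ℝ → ℝ≥0∞} (hf : Measurable f) :
    l2 (fun x => c * f x) = c * l2 f := by
  unfold l2
  simp only [mul_pow]
  rw [lintegral_const_mul _ (by fun_prop), ENNReal.mul_rpow_of_nonneg _ _ (by norm_num),
    sqrt_sq_ennreal]

section Weights

variable {N s : ℝ} {m : ℝ → ℝ} {f : ℝ → ℝ≥0∞}

theorem AdmissibleLow.l2_highWeight_mul_le (hm : AdmissibleLow N s m) (hN : 2 ≤ N)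
    (hf : Measurable f) :
    l2 (fun ξ => ENNReal.ofReal (highWeight N ξ) * f ξ) ≤
      16 * l2 (fun ξ => ENNReal.ofReal (m ξ * jap ξ) * f ξ) := by
  have hmc := hm.smooth.continuous.measurable
  have hj := continuous_jap.measurable
  rw [← l2_const_mul _ (by fun_prop)]
  refine l2_mono fun ξ => ?_
  rw [← mul_assoc, show (16 : ℝ≥0∞) = ENNReal.ofReal 16 by norm_num,
    ← ENNReal.ofReal_mul (by norm_num)]
  gcongr
  exact hm.highWeight_le hN ξ

theorem AdmissibleLow.lintegral_highWeight_mul_le (hm : AdmissibleLow N s m) (hN : 2 ≤ N)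
    (hf : Measurable f) :
    ∫⁻ ξ, ENNReal.ofReal (highWeight N ξ) * ENNReal.ofReal (m ξ) * f ξ ≤
      16 * l2 (fun ξ => ENNReal.ofReal (m ξ * jap ξ) * f ξ) := by
  have hmc := hm.smooth.continuous.measurable
  have hj := continuous_jap.measurable
  calc _ = ∫⁻ ξ, ENNReal.ofReal (highWeight N ξ / jap ξ) *
        (ENNReal.ofReal (m ξ * jap ξ) * f ξ) := by
        refine lintegral_congr fun ξ => ?_
        have h1 := one_le_highWeight N ξ
        have h2 := jap_pos ξ
        rw [← mul_assoc, ← ENNReal.ofReal_mul (by positivity), ← ENNReal.ofReal_mul (by positivity)]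
        congr 2
        field_simp
    _ ≤ (∫⁻ ξ, ENNReal.ofReal (highWeight N ξ / jap ξ) ^ 2) ^ (1 / 2 : ℝ) *
        l2 (fun ξ => ENNReal.ofReal (m ξ * jap ξ) * f ξ) :=
        lintegral_mul_le_sqrt _ (by fun_prop) (by fun_prop)
    _ ≤ _ := by
        gcongr
        rw [← sqrt_sq_ennreal 16]
        gcongr
        exact lintegral_highWeight_div_jap_sq_le (by linarith)

end Weights

theorem lintegral_prod_three {α β γ : Type*} [MeasureSpace α] [MeasureSpace β] [MeasureSpace γ]
    [SFinite (volume : Measure α)] [SFinite (volume : Measure β)] [SFinite (volume : Measure γ)]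
    {F : α × β × γ → ℝ≥0∞} (hF : Measurable F) :
    ∫⁻ e, F e = ∫⁻ a, ∫⁻ b, ∫⁻ c, F (a, b, c) := by
  rw [Measure.volume_eq_prod, lintegral_prod _ hF.aemeasurable]
  refine lintegral_congr fun a => ?_
  rw [Measure.volume_eq_prod, lintegral_prod _ (by fun_prop)]

/-- The first five frequencies on the hyperplane `ξ₁ + ⋯ + ξ₆ = 0`. -/
abbrev Freq : Type := (ℝ × ℝ) × ℝ × (ℝ × ℝ)

/-- The frequency determined by the other five. -/
def lastFreq (e : Freq) : ℝ := -(e.1.1 + e.1.2 + e.2.1 + e.2.2.1 + e.2.2.2)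

@[fun_prop]
theorem continuous_lastFreq : Continuous lastFreq := by unfold lastFreq; fun_prop

@[fun_prop]
theorem measurable_lastFreq : Measurable lastFreq := continuous_lastFreq.measurable

/-- The phase `ξ₁² - ξ₂² + ξ₃² - ξ₄² + ξ₅² - ξ₆²`. -/
def phase (e : Freq) : ℝ :=
  e.1.1 ^ 2 - e.1.2 ^ 2 + e.2.1 ^ 2 - e.2.2.1 ^ 2 + e.2.2.2 ^ 2 - lastFreq e ^ 2

@[fun_prop]
theorem continuous_phase : Continuous phase := by unfold phase; fun_prop

@[fun_prop]
theorem measurable_phase : Measurable phase := continuous_phase.measurable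

/-- The symbol `M₆` on the hyperplane. -/
def symbolSix (m : ℝ → ℝ) (e : Freq) : ℝ :=
  m (e.1.1 + e.1.2 + e.2.1) * m e.2.2.1 * m e.2.2.2 * m (lastFreq e) -
    m e.1.1 * m e.1.2 * m e.2.1 * m (e.2.2.1 + e.2.2.2 + lastFreq e)

theorem continuous_symbolSix {m : ℝ → ℝ} (hm : Continuous m) : Continuous (symbolSix m) := by
  unfold symbolSix; fun_prop

section

variable {f₁ f₂ f₃ f₄ f₅ f₆ : ℝ → ℝ≥0∞}

theorem AdmissibleLow.lintegral_symbolSix_le {N s : ℝ} {m : ℝ → ℝ} (hm : AdmissibleLow N s m)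
    (hN : 2 ≤ N) (m₁ : Measurable f₁) (m₂ : Measurable f₂) (m₃ : Measurable f₃)
    (m₄ : Measurable f₄) (m₅ : Measurable f₅) (m₆ : Measurable f₆) (A : ℝ) :
    ∫⁻ e : Freq, resonance (A + phase e) * (‖symbolSix m e‖ₑ *
        (f₁ e.1.1 * f₂ e.1.2 * f₃ e.2.1 * (f₄ e.2.2.1 * f₅ e.2.2.2 * f₆ (lastFreq e)))) ≤
      6 * 16 ^ 6 * ENNReal.ofReal N⁻¹ *
        (l2 (fun ξ => ENNReal.ofReal (m ξ * jap ξ) * f₁ ξ) *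
        l2 (fun ξ => ENNReal.ofReal (m ξ * jap ξ) * f₂ ξ) *
        l2 (fun ξ => ENNReal.ofReal (m ξ * jap ξ) * f₃ ξ) *
        (l2 (fun ξ => ENNReal.ofReal (m ξ * jap ξ) * f₄ ξ) *
        l2 (fun ξ => ENNReal.ofReal (m ξ * jap ξ) * f₅ ξ) *
        l2 (fun ξ => ENNReal.ofReal (m ξ * jap ξ) * f₆ ξ))) := by
  have hmm := hm.smooth.continuous.measurable
  have hm0 (ξ) : 0 ≤ m ξ := (hm.pos hN ξ).le
  have hw0 (ξ) : 0 ≤ highWeight N ξ := zero_le_one.trans (one_le_highWeight N ξ)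
  have hN0 : 0 < N := by linarith
  set g : (ℝ → ℝ≥0∞) → ℝ → ℝ≥0∞ := fun f ξ => ENNReal.ofReal (highWeight N ξ) * f ξ with hg
  set k : (ℝ → ℝ≥0∞) → ℝ → ℝ≥0∞ :=
    fun f ξ => ENNReal.ofReal (highWeight N ξ) * ENNReal.ofReal (m ξ) * f ξ with hk
  have hgm {f} (hf : Measurable f) : Measurable (g f) := by simp only [hg]; fun_prop
  have hkm {f} (hf : Measurable f) : Measurable (k f) := by simp only [hk]; fun_prop
  have g₁ := hgm m₁; have g₂ := hgm m₂; have g₃ := hgm m₃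
  have g₄ := hgm m₄; have g₅ := hgm m₅; have g₆ := hgm m₆
  have k₁ := hkm m₁; have k₂ := hkm m₂; have k₃ := hkm m₃
  have k₄ := hkm m₄; have k₅ := hkm m₅; have k₆ := hkm m₆
  set S : (ℝ → ℝ≥0∞) → ℝ≥0∞ := fun f => l2 (fun ξ => ENNReal.ofReal (m ξ * jap ξ) * f ξ) with hS
  have hgS {f} (hf : Measurable f) : l2 (g f) ≤ 16 * S f := hm.l2_highWeight_mul_le hN hf
  have hkS {f} (hf : Measurable f) : ∫⁻ ξ, k f ξ ≤ 16 * S f :=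
    hm.lintegral_highWeight_mul_le hN hf
  have hsymb (e : Freq) : ‖symbolSix m e‖ₑ ≤ ENNReal.ofReal N⁻¹ *
      (ENNReal.ofReal (highWeight N e.1.1) * ENNReal.ofReal (highWeight N e.1.2) *
        ENNReal.ofReal (highWeight N e.2.1) * (ENNReal.ofReal (highWeight N e.2.2.1) *
        ENNReal.ofReal (highWeight N e.2.2.2) * ENNReal.ofReal (highWeight N (lastFreq e)))) *
      (ENNReal.ofReal (m e.2.2.1) * ENNReal.ofReal (m e.2.2.2) * ENNReal.ofReal (m (lastFreq e)) +
        ENNReal.ofReal (m e.1.1) * ENNReal.ofReal (m e.1.2) * ENNReal.ofReal (m e.2.1)) := by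
    have h := hm.abs_symbol_le hN (ξ₁ := e.1.1) (ξ₂ := e.1.2) (ξ₃ := e.2.1) (ξ₄ := e.2.2.1)
      (ξ₅ := e.2.2.2) (ξ₆ := lastFreq e) (by unfold lastFreq; ring)
    rw [← ofReal_norm, Real.norm_eq_abs]
    refine (ENNReal.ofReal_le_ofReal h).trans_eq ?_
    have e₁ := hm0 e.1.1; have e₂ := hm0 e.1.2; have e₃ := hm0 e.2.1
    have e₄ := hm0 e.2.2.1; have e₅ := hm0 e.2.2.2; have e₆ := hm0 (lastFreq e)
    have w₁ := hw0 e.1.1; have w₂ := hw0 e.1.2; have w₃ := hw0 e.2.1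
    have w₄ := hw0 e.2.2.1; have w₅ := hw0 e.2.2.2; have w₆ := hw0 (lastFreq e)
    rw [ENNReal.ofReal_mul (by positivity), ENNReal.ofReal_mul (by positivity),
      ENNReal.ofReal_mul (by positivity), ENNReal.ofReal_mul (by positivity),
      ENNReal.ofReal_mul (by positivity), ENNReal.ofReal_mul (by positivity),
      ENNReal.ofReal_mul (by positivity), ENNReal.ofReal_add (by positivity) (by positivity),
      ENNReal.ofReal_mul (by positivity), ENNReal.ofReal_mul (by positivity),
      ENNReal.ofReal_mul (by positivity), ENNReal.ofReal_mul (by positivity)]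
  have hL : ∫⁻ e : Freq, resonance (A + phase e) * (g f₁ e.1.1 * g f₂ e.1.2 * g f₃ e.2.1 *
      (k f₄ e.2.2.1 * k f₅ e.2.2.2 * k f₆ (lastFreq e))) ≤
      3 * ((l2 (g f₁) * l2 (g f₂) * l2 (g f₃)) *
        ((∫⁻ ξ, k f₄ ξ) * (∫⁻ ξ, k f₅ ξ) * ∫⁻ ξ, k f₆ ξ)) := by
    rw [lintegral_prod_three (by fun_prop)]
    refine le_of_eq_of_le ?_ (lintegral_resonance_hexalinear_le_left g₁ g₂ g₃ k₄ k₅ k₆ A)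
    refine lintegral_congr fun p => lintegral_congr fun x => lintegral_congr fun q => ?_
    simp only [phase, lastFreq]
    congr 2
    ring
  have hR : ∫⁻ e : Freq, resonance (A + phase e) * (k f₁ e.1.1 * k f₂ e.1.2 * k f₃ e.2.1 *
      (g f₄ e.2.2.1 * g f₅ e.2.2.2 * g f₆ (lastFreq e))) ≤
      3 * (((∫⁻ ξ, k f₁ ξ) * (∫⁻ ξ, k f₂ ξ) * ∫⁻ ξ, k f₃ ξ) *
        (l2 (g f₄) * l2 (g f₅) * l2 (g f₆))) := by
    rw [lintegral_prod_three (by fun_prop)]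
    refine le_of_eq_of_le ?_ (lintegral_resonance_hexalinear_le_right k₁ k₂ k₃ g₄ g₅ g₆ A)
    refine lintegral_congr fun p => lintegral_congr fun x => lintegral_congr fun q => ?_
    simp only [phase, lastFreq]
    congr 2
    ring
  calc _ ≤ ∫⁻ e : Freq, ENNReal.ofReal N⁻¹ *
        (resonance (A + phase e) * (g f₁ e.1.1 * g f₂ e.1.2 * g f₃ e.2.1 *
          (k f₄ e.2.2.1 * k f₅ e.2.2.2 * k f₆ (lastFreq e))) +
        resonance (A + phase e) * (k f₁ e.1.1 * k f₂ e.1.2 * k f₃ e.2.1 *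
          (g f₄ e.2.2.1 * g f₅ e.2.2.2 * g f₆ (lastFreq e)))) := by
        refine lintegral_mono fun e => ?_
        refine (mul_le_mul_right (mul_le_mul_left (hsymb e) _) _).trans_eq ?_
        simp only [hg, hk]
        ring
    _ ≤ ENNReal.ofReal N⁻¹ *
        (3 * (((16 * S f₁) * (16 * S f₂) * (16 * S f₃)) *
          ((16 * S f₄) * (16 * S f₅) * (16 * S f₆))) +
        3 * (((16 * S f₁) * (16 * S f₂) * (16 * S f₃)) *
          ((16 * S f₄) * (16 * S f₅) * (16 * S f₆)))) := by
        rw [lintegral_const_mul _ (by fun_prop), lintegral_add_left (by fun_prop)]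
        gcongr ENNReal.ofReal N⁻¹ * (?_ + ?_)
        · refine hL.trans ?_
          gcongr
          exacts [hgS m₁, hgS m₂, hgS m₃, hkS m₄, hkS m₅, hkS m₆]
        · refine hR.trans ?_
          gcongr
          exacts [hkS m₁, hkS m₂, hkS m₃, hgS m₄, hgS m₅, hgS m₆]
    _ = _ := by ring

end

theorem enorm_integral_oscillation_le (a θ : ℝ) {δ : ℝ} (hδ : 0 < δ) (hδ1 : δ ≤ 1) :
    ‖∫ t in a..a + δ, Complex.exp (Complex.I * (t * θ : ℝ))‖ₑ ≤ 3 * resonance θ := by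
  set J := ∫ t in a..a + δ, Complex.exp (Complex.I * (t * θ : ℝ)) with hJ
  have h1 : ‖J‖ ≤ 1 := by
    refine (intervalIntegral.norm_integral_le_of_norm_le_const (C := 1) fun t _ => ?_).trans ?_
    · rw [mul_comm, Complex.norm_exp_ofReal_mul_I]
    · rw [add_sub_cancel_left, abs_of_pos hδ]; linarith
  have h2 : |θ| * ‖J‖ ≤ 2 := by
    rcases eq_or_ne θ 0 with rfl | hθ
    · simp
    · have hc : Complex.I * θ ≠ 0 := mul_ne_zero Complex.I_ne_zero (by exact_mod_cast hθ)
      have h3 : J = (Complex.exp (Complex.I * θ * (a + δ : ℝ)) - Complex.exp (Complex.I * θ * a)) /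
          (Complex.I * θ) := by
        rw [← integral_exp_mul_complex hc, hJ]
        refine intervalIntegral.integral_congr fun t _ => ?_
        congr 1
        push_cast
        ring
      have h4 (x : ℝ) : ‖Complex.exp (Complex.I * θ * x)‖ = 1 := by
        rw [show Complex.I * θ * x = ((θ * x : ℝ) : ℂ) * Complex.I by push_cast; ring,
          Complex.norm_exp_ofReal_mul_I]
      rw [h3, norm_div, norm_mul, Complex.norm_I, one_mul, Complex.norm_real, Real.norm_eq_abs,
        mul_div_cancel₀ _ (abs_ne_zero.2 hθ)]
      refine (norm_sub_le _ _).trans ?_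
      rw [h4, h4]
      norm_num
  unfold resonance
  rw [← ofReal_norm, show (3 : ℝ≥0∞) = ENNReal.ofReal 3 by norm_num,
    ← ENNReal.ofReal_mul (by norm_num)]
  refine ENNReal.ofReal_le_ofReal ?_
  rw [← div_eq_mul_inv, le_div_iff₀ (by positivity)]
  linarith

theorem enorm_integral_integral_oscillation_le {Ω : Type*} [MeasurableSpace Ω] {μ : Measure Ω}
    [SFinite μ] {H : Ω → ℂ} (hH : Integrable H μ) {θ : Ω → ℝ} (hθ : Measurable θ) (a : ℝ) {δ : ℝ}
    (hδ : 0 < δ) (hδ1 : δ ≤ 1) :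
    ‖∫ t in a..a + δ, ∫ ω, Complex.exp (Complex.I * (t * θ ω : ℝ)) * H ω ∂μ‖ₑ ≤
      ∫⁻ ω, 3 * resonance (θ ω) * ‖H ω‖ₑ ∂μ := by
  have h_int : Integrable (Function.uncurry fun (t : ℝ) (ω : Ω) =>
      Complex.exp (Complex.I * (t * θ ω : ℝ)) * H ω)
      ((volume.restrict (Set.Ioc a (a + δ))).prod μ) := by
    have h1 : Integrable (fun z : ℝ × Ω => H z.2)
        ((volume.restrict (Set.Ioc a (a + δ))).prod μ) := hH.comp_snd _
    refine h1.bdd_mul (c := 1) ?_ (.of_forall fun z => ?_)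
    · refine Measurable.aestronglyMeasurable ?_
      fun_prop
    · rw [mul_comm, Complex.norm_exp_ofReal_mul_I]
  rw [intervalIntegral.integral_of_le (by linarith), integral_integral_swap h_int]
  refine (enorm_integral_le_lintegral_enorm _).trans (lintegral_mono fun ω => ?_)
  rw [integral_mul_const, enorm_mul, ← intervalIntegral.integral_of_le (by linarith)]
  gcongr
  exact enorm_integral_oscillation_le a (θ ω) hδ hδ1

theorem integral_freq {G : Freq → ℂ} (hG : Integrable G) :
    ∫ e, G e = ∫ ξ₁ : ℝ, ∫ ξ₂ : ℝ, ∫ ξ₃ : ℝ, ∫ ξ₄ : ℝ, ∫ ξ₅ : ℝ, G ((ξ₁, ξ₂), ξ₃, (ξ₄, ξ₅)) := by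
  rw [Measure.volume_eq_prod] at hG
  have h1 : (fun p => ∫ r, G (p, r)) =ᵐ[volume] fun p => ∫ x : ℝ, ∫ a : ℝ, ∫ b : ℝ,
      G (p, x, (a, b)) := by
    filter_upwards [hG.prod_right_ae] with p hp
    rw [Measure.volume_eq_prod] at hp
    rw [Measure.volume_eq_prod, integral_prod _ hp]
    refine integral_congr_ae ?_
    filter_upwards [hp.prod_right_ae] with x hx
    rw [Measure.volume_eq_prod] at hx
    rw [Measure.volume_eq_prod, integral_prod _ hx]
  have h2 := hG.integral_prod_left.congr h1
  rw [Measure.volume_eq_prod] at h2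
  rw [Measure.volume_eq_prod, integral_prod _ hG, integral_congr_ae h1, Measure.volume_eq_prod,
    integral_prod _ h2]

/-- The modulation variables of six functions. -/
abbrev Modulation : Type := ((ℝ × ℝ) × ℝ) × ((ℝ × ℝ) × ℝ)

theorem integral_modulation (f₁ f₂ f₃ f₄ f₅ f₆ : ℝ → ℂ) :
    ∫ z : Modulation, f₁ z.1.1.1 * f₂ z.1.1.2 * f₃ z.1.2 *
        (f₄ z.2.1.1 * f₅ z.2.1.2 * f₆ z.2.2) =
      (∫ x, f₁ x) * (∫ x, f₂ x) * (∫ x, f₃ x) * ((∫ x, f₄ x) * (∫ x, f₅ x) * ∫ x, f₆ x) := by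
  have h (f g k : ℝ → ℂ) : ∫ z : (ℝ × ℝ) × ℝ, f z.1.1 * g z.1.2 * k z.2 =
      (∫ x, f x) * (∫ x, g x) * ∫ x, k x := by
    rw [Measure.volume_eq_prod, integral_prod_mul (fun z : ℝ × ℝ => f z.1 * g z.2) k,
      Measure.volume_eq_prod, integral_prod_mul]
  rw [Measure.volume_eq_prod, integral_prod_mul
    (fun z : (ℝ × ℝ) × ℝ => f₁ z.1.1 * f₂ z.1.2 * f₃ z.2)
    (fun z : (ℝ × ℝ) × ℝ => f₄ z.1.1 * f₅ z.1.2 * f₆ z.2), h, h]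

theorem lintegral_modulation {f₁ f₂ f₃ f₄ f₅ f₆ : ℝ → ℝ≥0∞} (m₁ : Measurable f₁)
    (m₂ : Measurable f₂) (m₃ : Measurable f₃) (m₄ : Measurable f₄) (m₅ : Measurable f₅)
    (m₆ : Measurable f₆) :
    ∫⁻ z : Modulation, f₁ z.1.1.1 * f₂ z.1.1.2 * f₃ z.1.2 *
        (f₄ z.2.1.1 * f₅ z.2.1.2 * f₆ z.2.2) =
      (∫⁻ x, f₁ x) * (∫⁻ x, f₂ x) * (∫⁻ x, f₃ x) *
        ((∫⁻ x, f₄ x) * (∫⁻ x, f₅ x) * ∫⁻ x, f₆ x) := by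
  have h {f g k : ℝ → ℝ≥0∞} (hf : Measurable f) (hg : Measurable g) (hk : Measurable k) :
      ∫⁻ z : (ℝ × ℝ) × ℝ, f z.1.1 * g z.1.2 * k z.2 = (∫⁻ x, f x) * (∫⁻ x, g x) * ∫⁻ x, k x := by
    rw [Measure.volume_eq_prod, lintegral_prod_mul (f := fun z : ℝ × ℝ => f z.1 * g z.2)
      (by fun_prop) (by fun_prop), Measure.volume_eq_prod, lintegral_prod_mul (by fun_prop)
      (by fun_prop)]
  rw [Measure.volume_eq_prod, lintegral_prod_mul
    (f := fun z : (ℝ × ℝ) × ℝ => f₁ z.1.1 * f₂ z.1.2 * f₃ z.2)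
    (g := fun z : (ℝ × ℝ) × ℝ => f₄ z.1.1 * f₅ z.1.2 * f₆ z.2) (by fun_prop) (by fun_prop),
    h m₁ m₂ m₃, h m₄ m₅ m₆]

theorem Complex.enorm_ofReal (r : ℝ) : ‖(r : ℂ)‖ₑ = ‖r‖ₑ := by
  rw [← ofReal_norm, ← ofReal_norm, Complex.norm_real]

theorem lintegral_freq_ne_top : ∫⁻ e : Freq, ENNReal.ofReal ((1 + e.1.1 ^ 2)⁻¹) *
    ENNReal.ofReal ((1 + e.1.2 ^ 2)⁻¹) * (ENNReal.ofReal ((1 + e.2.1 ^ 2)⁻¹) *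
    (ENNReal.ofReal ((1 + e.2.2.1 ^ 2)⁻¹) * ENNReal.ofReal ((1 + e.2.2.2 ^ 2)⁻¹))) ≠ ∞ := by
  set φ : ℝ → ℝ≥0∞ := fun x => ENNReal.ofReal ((1 + x ^ 2)⁻¹) with hφ
  have hm : Measurable φ := by fun_prop
  have h2 : ∫⁻ p : ℝ × ℝ, φ p.1 * φ p.2 = ENNReal.ofReal π * ENNReal.ofReal π := by
    rw [Measure.volume_eq_prod, lintegral_prod_mul (by fun_prop) (by fun_prop),
      lintegral_inv_one_add_sq]
  have h3 : ∫⁻ r : ℝ × (ℝ × ℝ), φ r.1 * (φ r.2.1 * φ r.2.2) =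
      ENNReal.ofReal π * (ENNReal.ofReal π * ENNReal.ofReal π) := by
    rw [Measure.volume_eq_prod, lintegral_prod_mul (f := φ) (g := fun p : ℝ × ℝ => φ p.1 * φ p.2)
      (by fun_prop) (by fun_prop), lintegral_inv_one_add_sq, h2]
  change ∫⁻ e : Freq, φ e.1.1 * φ e.1.2 * (φ e.2.1 * (φ e.2.2.1 * φ e.2.2.2)) ≠ ∞
  rw [Measure.volume_eq_prod, lintegral_prod_mul (f := fun p : ℝ × ℝ => φ p.1 * φ p.2)
    (g := fun r : ℝ × (ℝ × ℝ) => φ r.1 * (φ r.2.1 * φ r.2.2)) (by fun_prop) (by fun_prop), h2, h3]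
  finiteness

/-- The amplitude of a product of six superpositions of free waves against the symbol `M₆`. -/
def amplitude (m : ℝ → ℝ) (b₁ b₂ b₃ b₄ b₅ b₆ : ℝ → ℝ → ℂ) (w : Freq × Modulation) : ℂ :=
  symbolSix m w.1 * (b₁ w.1.1.1 w.2.1.1.1 * b₂ w.1.1.2 w.2.1.1.2 * b₃ w.1.2.1 w.2.1.2 *
    (b₄ w.1.2.2.1 w.2.2.1.1 * b₅ w.1.2.2.2 w.2.2.1.2 * b₆ (lastFreq w.1) w.2.2.2))

/-- The contribution of the modulations to the total phase. -/
def modulationPhase (z : Modulation) : ℝ :=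
  z.1.1.1 - z.1.1.2 + z.1.2 - z.2.1.1 + z.2.1.2 - z.2.2

@[fun_prop]
theorem measurable_modulationPhase : Measurable modulationPhase := by
  unfold modulationPhase; fun_prop

section

variable {N s : ℝ} {m : ℝ → ℝ} {b₁ b₂ b₃ b₄ b₅ b₆ : ℝ → ℝ → ℂ}

theorem continuous_amplitude (hm : Continuous m)
    (h₁ : Continuous fun p : ℝ × ℝ => b₁ p.1 p.2) (h₂ : Continuous fun p : ℝ × ℝ => b₂ p.1 p.2)
    (h₃ : Continuous fun p : ℝ × ℝ => b₃ p.1 p.2) (h₄ : Continuous fun p : ℝ × ℝ => b₄ p.1 p.2)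
    (h₅ : Continuous fun p : ℝ × ℝ => b₅ p.1 p.2) (h₆ : Continuous fun p : ℝ × ℝ => b₆ p.1 p.2) :
    Continuous (amplitude m b₁ b₂ b₃ b₄ b₅ b₆) := by
  have hs := continuous_symbolSix hm
  have hc {b : ℝ → ℝ → ℂ} (hb : Continuous fun p : ℝ × ℝ => b p.1 p.2)
      {f g : Freq × Modulation → ℝ} (hf : Continuous f) (hg : Continuous g) :
      Continuous fun w => b (f w) (g w) := hb.comp (hf.prodMk hg)
  unfold amplitude
  refine Continuous.mul (by fun_prop) (((Continuous.mul ?_ ?_).mul ?_).mul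
    ((Continuous.mul ?_ ?_).mul ?_))
  · exact hc h₁ (by fun_prop) (by fun_prop)
  · exact hc h₂ (by fun_prop) (by fun_prop)
  · exact hc h₃ (by fun_prop) (by fun_prop)
  · exact hc h₄ (by fun_prop) (by fun_prop)
  · exact hc h₅ (by fun_prop) (by fun_prop)
  · exact hc h₆ (by fun_prop) (by fun_prop)

theorem AdmissibleLow.enorm_symbolSix_le (hm : AdmissibleLow N s m) (hN : 2 ≤ N) (e : Freq) :
    ‖symbolSix m e‖ₑ ≤ 2 := by
  have hm1 (ξ) : ‖m ξ‖ₑ ≤ 1 := by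
    rw [← ofReal_norm, Real.norm_of_nonneg (hm.pos hN ξ).le]
    exact ENNReal.ofReal_le_one.2 (hm.le_one hN ξ)
  have h4 (a b c d : ℝ) : ‖m a * m b * m c * m d‖ₑ ≤ 1 := by
    simp only [enorm_mul]
    calc _ ≤ (1 : ℝ≥0∞) * 1 * 1 * 1 := by gcongr <;> exact hm1 _
      _ = 1 := by simp
  calc ‖symbolSix m e‖ₑ ≤ _ := enorm_sub_le
    _ ≤ 1 + 1 := add_le_add (h4 _ _ _ _) (h4 _ _ _ _)
    _ = 2 := one_add_one_eq_two

variable {U₁ U₂ U₃ U₄ U₅ U₆ : ℝ → ℝ → ℂ} {ς₁ ς₂ ς₃ ς₄ ς₅ ς₆ X₁ X₂ X₃ X₄ X₅ X₆ : ℝ}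

theorem IsFreeSuperposition.measurable {m : ℝ → ℝ} {U b : ℝ → ℝ → ℂ} {ς X : ℝ}
    (h : IsFreeSuperposition m U ς X b) (ξ : ℝ) : Measurable fun σ => ‖b ξ σ‖ₑ :=
  (h.cont.comp (Continuous.prodMk_right ξ)).measurable.enorm

theorem integrable_amplitude (hm : AdmissibleLow N s m) (hN : 2 ≤ N)
    (h₁ : IsFreeSuperposition m U₁ ς₁ X₁ b₁) (h₂ : IsFreeSuperposition m U₂ ς₂ X₂ b₂)
    (h₃ : IsFreeSuperposition m U₃ ς₃ X₃ b₃) (h₄ : IsFreeSuperposition m U₄ ς₄ X₄ b₄)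
    (h₅ : IsFreeSuperposition m U₅ ς₅ X₅ b₅) (h₆ : IsFreeSuperposition m U₆ ς₆ X₆ b₆) :
    Integrable (amplitude m b₁ b₂ b₃ b₄ b₅ b₆) := by
  have hc := continuous_amplitude hm.smooth.continuous h₁.cont h₂.cont h₃.cont h₄.cont h₅.cont
    h₆.cont
  refine ⟨hc.aestronglyMeasurable, ?_⟩
  have hd {U b : ℝ → ℝ → ℂ} {ς X : ℝ} (h : IsFreeSuperposition m U ς X b) :
      ∃ D : ℝ≥0∞, D ≠ ∞ ∧ ∀ ξ, ∫⁻ σ, ‖b ξ σ‖ₑ ≤ D * ENNReal.ofReal ((1 + ξ ^ 2)⁻¹) := by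
    obtain ⟨D, hD⟩ := h.decay
    refine ⟨ENNReal.ofReal |D|, ENNReal.ofReal_ne_top, fun ξ => (hD ξ).trans ?_⟩
    rw [← ENNReal.ofReal_mul (abs_nonneg D)]
    gcongr
    exact le_abs_self D
  obtain ⟨D₁, n₁, d₁⟩ := hd h₁
  obtain ⟨D₂, n₂, d₂⟩ := hd h₂
  obtain ⟨D₃, n₃, d₃⟩ := hd h₃
  obtain ⟨D₄, n₄, d₄⟩ := hd h₄
  obtain ⟨D₅, n₅, d₅⟩ := hd h₅
  obtain ⟨D₆, n₆, d₆⟩ := hd h₆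
  have d₆' (ξ : ℝ) : ∫⁻ σ, ‖b₆ ξ σ‖ₑ ≤ D₆ * 1 := by
    refine (d₆ ξ).trans ?_
    gcongr
    exact ENNReal.ofReal_le_one.2 (inv_le_one_of_one_le₀ (by nlinarith [sq_nonneg ξ]))
  unfold HasFiniteIntegral
  rw [Measure.volume_eq_prod, lintegral_prod _ hc.measurable.enorm.aemeasurable]
  calc _ ≤ ∫⁻ e : Freq, (2 * (D₁ * D₂ * D₃ * (D₄ * D₅ * (D₆ * 1)))) *
        (ENNReal.ofReal ((1 + e.1.1 ^ 2)⁻¹) *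
        ENNReal.ofReal ((1 + e.1.2 ^ 2)⁻¹) * (ENNReal.ofReal ((1 + e.2.1 ^ 2)⁻¹) *
        (ENNReal.ofReal ((1 + e.2.2.1 ^ 2)⁻¹) * ENNReal.ofReal ((1 + e.2.2.2 ^ 2)⁻¹)))) := by
        refine lintegral_mono fun e => ?_
        simp only [amplitude, enorm_mul, Complex.enorm_ofReal]
        rw [lintegral_const_mul' _ _ enorm_ne_top, lintegral_modulation (h₁.measurable _)
          (h₂.measurable _) (h₃.measurable _) (h₄.measurable _) (h₅.measurable _) (h₆.measurable _)]
        refine (mul_le_mul' (hm.enorm_symbolSix_le hN e) (mul_le_mul' (mul_le_mul' (mul_le_mul'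
          (d₁ _) (d₂ _)) (d₃ _)) (mul_le_mul' (mul_le_mul' (d₄ _) (d₅ _)) (d₆' _)))).trans_eq ?_
        ring
    _ < ∞ := by
        rw [lintegral_const_mul' _ _ (by finiteness)]
        exact ENNReal.mul_lt_top (by finiteness) lintegral_freq_ne_top.lt_top

theorem lintegral_resonance_amplitude_le (hm : AdmissibleLow N s m) (hN : 2 ≤ N)
    (h₁ : IsFreeSuperposition m U₁ ς₁ X₁ b₁) (h₂ : IsFreeSuperposition m U₂ ς₂ X₂ b₂)
    (h₃ : IsFreeSuperposition m U₃ ς₃ X₃ b₃) (h₄ : IsFreeSuperposition m U₄ ς₄ X₄ b₄)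
    (h₅ : IsFreeSuperposition m U₅ ς₅ X₅ b₅) (h₆ : IsFreeSuperposition m U₆ ς₆ X₆ b₆) :
    ∫⁻ w, 3 * resonance (modulationPhase w.2 + phase w.1) * ‖amplitude m b₁ b₂ b₃ b₄ b₅ b₆ w‖ₑ ≤
      3 * (6 * 16 ^ 6 * ENNReal.ofReal N⁻¹) *
        ((4 * ENNReal.ofReal X₁) * (4 * ENNReal.ofReal X₂) * (4 * ENNReal.ofReal X₃) *
        ((4 * ENNReal.ofReal X₄) * (4 * ENNReal.ofReal X₅) * (4 * ENNReal.ofReal X₆))) := by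
  have hc := (continuous_amplitude hm.smooth.continuous h₁.cont h₂.cont h₃.cont h₄.cont h₅.cont
    h₆.cont).measurable
  have hmm := hm.smooth.continuous.measurable
  have hj := continuous_jap.measurable
  have hs {U b : ℝ → ℝ → ℂ} {ς X : ℝ} (h : IsFreeSuperposition m U ς X b) (σ : ℝ) :
      Measurable fun ξ => ‖b ξ σ‖ₑ := (h.cont.comp (Continuous.prodMk_left σ)).measurable.enorm
  have hl {U b : ℝ → ℝ → ℂ} {ς X : ℝ} (h : IsFreeSuperposition m U ς X b) :
      Measurable fun σ => l2 fun ξ => ENNReal.ofReal (m ξ * jap ξ) * ‖b ξ σ‖ₑ := by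
    unfold l2
    refine Measurable.pow_const (Measurable.lintegral_prod_left' (f := fun p : ℝ × ℝ =>
      (ENNReal.ofReal (m p.1 * jap p.1) * ‖b p.1 p.2‖ₑ) ^ 2) ?_) _
    have := h.cont.measurable.enorm
    fun_prop
  rw [Measure.volume_eq_prod, lintegral_prod_symm' _ (by fun_prop)]
  calc _ ≤ ∫⁻ z : Modulation, 3 * (6 * 16 ^ 6 * ENNReal.ofReal N⁻¹) *
        (l2 (fun ξ => ENNReal.ofReal (m ξ * jap ξ) * ‖b₁ ξ z.1.1.1‖ₑ) *
        l2 (fun ξ => ENNReal.ofReal (m ξ * jap ξ) * ‖b₂ ξ z.1.1.2‖ₑ) *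
        l2 (fun ξ => ENNReal.ofReal (m ξ * jap ξ) * ‖b₃ ξ z.1.2‖ₑ) *
        (l2 (fun ξ => ENNReal.ofReal (m ξ * jap ξ) * ‖b₄ ξ z.2.1.1‖ₑ) *
        l2 (fun ξ => ENNReal.ofReal (m ξ * jap ξ) * ‖b₅ ξ z.2.1.2‖ₑ) *
        l2 (fun ξ => ENNReal.ofReal (m ξ * jap ξ) * ‖b₆ ξ z.2.2‖ₑ))) := by
        refine lintegral_mono fun z => ?_
        simp only [amplitude, enorm_mul, Complex.enorm_ofReal]
        simp_rw [mul_assoc (3 : ℝ≥0∞)]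
        rw [lintegral_const_mul' _ _ (by norm_num)]
        gcongr
        exact hm.lintegral_symbolSix_le hN (hs h₁ _) (hs h₂ _) (hs h₃ _) (hs h₄ _) (hs h₅ _)
          (hs h₆ _) _
    _ ≤ _ := by
        rw [lintegral_const_mul' _ _ (by finiteness), lintegral_modulation (hl h₁) (hl h₂) (hl h₃)
          (hl h₄) (hl h₅) (hl h₆)]
        gcongr
        exacts [h₁.bound, h₂.bound, h₃.bound, h₄.bound, h₅.bound, h₆.bound]

theorem integral_oscillation_amplitude
    (h₁ : IsFreeSuperposition m U₁ 1 X₁ b₁) (h₂ : IsFreeSuperposition m U₂ (-1) X₂ b₂)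
    (h₃ : IsFreeSuperposition m U₃ 1 X₃ b₃) (h₄ : IsFreeSuperposition m U₄ (-1) X₄ b₄)
    (h₅ : IsFreeSuperposition m U₅ 1 X₅ b₅) (h₆ : IsFreeSuperposition m U₆ (-1) X₆ b₆)
    (e : Freq) (t : ℝ) :
    ∫ z, Complex.exp (Complex.I * (t * (modulationPhase z + phase e) : ℝ)) *
        amplitude m b₁ b₂ b₃ b₄ b₅ b₆ (e, z) =
      symbolSix m e * U₁ e.1.1 t * U₂ e.1.2 t * U₃ e.2.1 t * U₄ e.2.2.1 t * U₅ e.2.2.2 t *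
        U₆ (lastFreq e) t := by
  rw [h₁.repr, h₂.repr, h₃.repr, h₄.repr, h₅.repr, h₆.repr]
  set g : ℝ → ℝ → (ℝ → ℝ → ℂ) → ℝ → ℂ := fun ς ξ b σ =>
    Complex.exp (Complex.I * (t * (ς * (ξ ^ 2 + σ)) : ℝ)) * b ξ σ with hg
  trans symbolSix m e * ∫ z : Modulation, g 1 e.1.1 b₁ z.1.1.1 * g (-1) e.1.2 b₂ z.1.1.2 *
    g 1 e.2.1 b₃ z.1.2 * (g (-1) e.2.2.1 b₄ z.2.1.1 * g 1 e.2.2.2 b₅ z.2.1.2 *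
    g (-1) (lastFreq e) b₆ z.2.2)
  · rw [← integral_const_mul]
    congr 1 with z
    have hexp : Complex.exp (Complex.I * (t * (modulationPhase z + phase e) : ℝ)) =
        Complex.exp (Complex.I * (t * (1 * (e.1.1 ^ 2 + z.1.1.1)) : ℝ)) *
        Complex.exp (Complex.I * (t * (-1 * (e.1.2 ^ 2 + z.1.1.2)) : ℝ)) *
        Complex.exp (Complex.I * (t * (1 * (e.2.1 ^ 2 + z.1.2)) : ℝ)) *
        Complex.exp (Complex.I * (t * (-1 * (e.2.2.1 ^ 2 + z.2.1.1)) : ℝ)) *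
        Complex.exp (Complex.I * (t * (1 * (e.2.2.2 ^ 2 + z.2.1.2)) : ℝ)) *
        Complex.exp (Complex.I * (t * (-1 * (lastFreq e ^ 2 + z.2.2)) : ℝ)) := by
      simp only [← Complex.exp_add]
      congr 1
      simp only [phase, modulationPhase]
      push_cast
      ring
    rw [hexp]
    simp only [hg, amplitude]
    ring
  · rw [integral_modulation]
    ring

theorem integrable_oscillation_amplitude (hm : AdmissibleLow N s m) (hN : 2 ≤ N)
    (h₁ : IsFreeSuperposition m U₁ ς₁ X₁ b₁) (h₂ : IsFreeSuperposition m U₂ ς₂ X₂ b₂)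
    (h₃ : IsFreeSuperposition m U₃ ς₃ X₃ b₃) (h₄ : IsFreeSuperposition m U₄ ς₄ X₄ b₄)
    (h₅ : IsFreeSuperposition m U₅ ς₅ X₅ b₅) (h₆ : IsFreeSuperposition m U₆ ς₆ X₆ b₆) (t : ℝ) :
    Integrable fun w : Freq × Modulation =>
      Complex.exp (Complex.I * (t * (modulationPhase w.2 + phase w.1) : ℝ)) *
        amplitude m b₁ b₂ b₃ b₄ b₅ b₆ w := by
  refine (integrable_amplitude hm hN h₁ h₂ h₃ h₄ h₅ h₆).bdd_mul (c := 1) ?_ (.of_forall fun z => ?_)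
  · refine Measurable.aestronglyMeasurable ?_
    fun_prop
  · rw [mul_comm, Complex.norm_exp_ofReal_mul_I]

theorem integral_symbolSix_mul (hm : AdmissibleLow N s m) (hN : 2 ≤ N)
    (h₁ : IsFreeSuperposition m U₁ 1 X₁ b₁) (h₂ : IsFreeSuperposition m U₂ (-1) X₂ b₂)
    (h₃ : IsFreeSuperposition m U₃ 1 X₃ b₃) (h₄ : IsFreeSuperposition m U₄ (-1) X₄ b₄)
    (h₅ : IsFreeSuperposition m U₅ 1 X₅ b₅) (h₆ : IsFreeSuperposition m U₆ (-1) X₆ b₆) (t : ℝ) :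
    ∫ ξ₁ : ℝ, ∫ ξ₂ : ℝ, ∫ ξ₃ : ℝ, ∫ ξ₄ : ℝ, ∫ ξ₅ : ℝ,
      symbolSix m ((ξ₁, ξ₂), ξ₃, (ξ₄, ξ₅)) * U₁ ξ₁ t * U₂ ξ₂ t * U₃ ξ₃ t * U₄ ξ₄ t * U₅ ξ₅ t *
        U₆ (lastFreq ((ξ₁, ξ₂), ξ₃, (ξ₄, ξ₅))) t =
      ∫ w, Complex.exp (Complex.I * (t * (modulationPhase w.2 + phase w.1) : ℝ)) *
        amplitude m b₁ b₂ b₃ b₄ b₅ b₆ w := by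
  have hi := integrable_oscillation_amplitude hm hN h₁ h₂ h₃ h₄ h₅ h₆ t
  rw [Measure.volume_eq_prod] at hi ⊢
  have hG := hi.integral_prod_left
  rw [integral_prod _ hi]
  simp only [integral_oscillation_amplitude h₁ h₂ h₃ h₄ h₅ h₆] at hG ⊢
  exact (integral_freq hG).symm

theorem norm_integral_symbolSix_le (hm : AdmissibleLow N s m) (hN : 2 ≤ N)
    (h₁ : IsFreeSuperposition m U₁ 1 X₁ b₁) (h₂ : IsFreeSuperposition m U₂ (-1) X₂ b₂)
    (h₃ : IsFreeSuperposition m U₃ 1 X₃ b₃) (h₄ : IsFreeSuperposition m U₄ (-1) X₄ b₄)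
    (h₅ : IsFreeSuperposition m U₅ 1 X₅ b₅) (h₆ : IsFreeSuperposition m U₆ (-1) X₆ b₆)
    (p₁ : 0 ≤ X₁) (p₂ : 0 ≤ X₂) (p₃ : 0 ≤ X₃) (p₄ : 0 ≤ X₄) (p₅ : 0 ≤ X₅) (p₆ : 0 ≤ X₆)
    (a : ℝ) {δ : ℝ} (hδ : 0 < δ) (hδ1 : δ ≤ 1) :
    ‖∫ t in a..a + δ, ∫ ξ₁ : ℝ, ∫ ξ₂ : ℝ, ∫ ξ₃ : ℝ, ∫ ξ₄ : ℝ, ∫ ξ₅ : ℝ,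
      symbolSix m ((ξ₁, ξ₂), ξ₃, (ξ₄, ξ₅)) * U₁ ξ₁ t * U₂ ξ₂ t * U₃ ξ₃ t * U₄ ξ₄ t * U₅ ξ₅ t *
        U₆ (lastFreq ((ξ₁, ξ₂), ξ₃, (ξ₄, ξ₅))) t‖ ≤
      3 * 6 * 16 ^ 6 * 4 ^ 6 * N⁻¹ * (X₁ * X₂ * X₃ * X₄ * X₅ * X₆) := by
  have hN0 : 0 ≤ N⁻¹ := by positivity
  simp only [integral_symbolSix_mul hm hN h₁ h₂ h₃ h₄ h₅ h₆]
  rw [← ENNReal.ofReal_le_ofReal_iff (by positivity), ofReal_norm]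
  refine (enorm_integral_integral_oscillation_le
    (integrable_amplitude hm hN h₁ h₂ h₃ h₄ h₅ h₆)
    (θ := fun w => modulationPhase w.2 + phase w.1) (by fun_prop) a hδ hδ1).trans
    ((lintegral_resonance_amplitude_le hm hN h₁ h₂ h₃ h₄ h₅ h₆).trans_eq ?_)
  have hc : ENNReal.ofReal (3 * 6 * 16 ^ 6 * 4 ^ 6) = 3 * 6 * 16 ^ 6 * 4 ^ 6 := by
    norm_num
  rw [ENNReal.ofReal_mul (by positivity), ENNReal.ofReal_mul (by positivity), hc,
    ENNReal.ofReal_mul (by positivity), ENNReal.ofReal_mul (by positivity),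
    ENNReal.ofReal_mul (by positivity), ENNReal.ofReal_mul (by positivity),
    ENNReal.ofReal_mul (by positivity)]
  ring

end

theorem XsbNorm_nonneg (s b : ℝ) (u : ℝ → ℝ → ℂ) : 0 ≤ XsbNorm s b u := by
  refine Real.rpow_nonneg (integral_nonneg fun ξ => integral_nonneg fun τ => ?_) _
  have h (ξ : ℝ) : 0 ≤ jap ξ := add_nonneg zero_le_one (abs_nonneg ξ)
  exact mul_nonneg (mul_nonneg (Real.rpow_nonneg (h _) _) (Real.rpow_nonneg (h _) _))
    (by positivity)

/-- the `Λ₆` estimate with symbol `M₆`. -/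
theorem lambda6_estimate
    (s ε : ℝ) (hs0 : 0 ≤ s) (hs1 : s < 1) (hε : 0 < ε) :
    ∃ ε' C : ℝ, 0 < ε' ∧ 0 < C ∧
      ∀ N : ℝ, 2 ≤ N → ∀ m : ℝ → ℝ, AdmissibleLow N s m →
      ∀ t₀ δ : ℝ, 0 < δ → δ ≤ 1 →
      ∀ u₁ u₂ u₃ u₄ u₅ u₆ : ℝ → ℝ → ℂ,
      IsSchwartz2 u₁ → IsSchwartz2 u₂ → IsSchwartz2 u₃ →
      IsSchwartz2 u₄ → IsSchwartz2 u₅ → IsSchwartz2 u₆ →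
      ‖(∫ t in t₀..(t₀ + δ),
          Lam6 (fun ξ₁ ξ₂ ξ₃ ξ₄ ξ₅ ξ₆ =>
              m (ξ₁ + ξ₂ + ξ₃) * m ξ₄ * m ξ₅ * m ξ₆ - m ξ₁ * m ξ₂ * m ξ₃ * m (ξ₄ + ξ₅ + ξ₆))
            (fun x => u₁ x t) (cj fun x => u₂ x t) (fun x => u₃ x t)
            (cj fun x => u₄ x t) (fun x => u₅ x t) (cj fun x => u₆ x t))‖
        ≤ C * N ^ (-1 + ε) * (XsbNorm 1 (1 / 2 + ε') (multX m u₁)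
          * XsbNorm 1 (1 / 2 + ε') (multX m u₂) * XsbNorm 1 (1 / 2 + ε') (multX m u₃)
          * XsbNorm 1 (1 / 2 + ε') (multX m u₄) * XsbNorm 1 (1 / 2 + ε') (multX m u₅)
          * XsbNorm 1 (1 / 2 + ε') (multX m u₆)) := by
  refine ⟨1 / 2, 3 * 6 * 16 ^ 6 * 4 ^ 6, by norm_num, by norm_num, ?_⟩
  intro N hN m hm t₀ δ hδ hδ1 u₁ u₂ u₃ u₄ u₅ u₆ hu₁ hu₂ hu₃ hu₄ hu₅ hu₆
  obtain ⟨b₁, h₁⟩ := exists_isFreeSuperposition hm hN hu₁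
  obtain ⟨b₂, h₂⟩ := exists_isFreeSuperposition hm hN hu₂
  obtain ⟨b₃, h₃⟩ := exists_isFreeSuperposition hm hN hu₃
  obtain ⟨b₄, h₄⟩ := exists_isFreeSuperposition hm hN hu₄
  obtain ⟨b₅, h₅⟩ := exists_isFreeSuperposition hm hN hu₅
  obtain ⟨b₆, h₆⟩ := exists_isFreeSuperposition hm hN hu₆
  have hX (u : ℝ → ℝ → ℂ) := XsbNorm_nonneg 1 (1 / 2 + 1 / 2) (multX m u)
  refine (norm_integral_symbolSix_le hm hN h₁ (h₂.conj hm) h₃ (h₄.conj hm) h₅ (h₆.conj hm)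
    (hX u₁) (hX u₂) (hX u₃) (hX u₄) (hX u₅) (hX u₆) t₀ hδ hδ1).trans ?_
  have hpow : N⁻¹ ≤ N ^ (-1 + ε) := by
    rw [← Real.rpow_neg_one]
    exact Real.rpow_le_rpow_of_exponent_le (by linarith) (by linarith)
  have hprod := mul_nonneg (mul_nonneg (mul_nonneg (mul_nonneg (mul_nonneg (hX u₁) (hX u₂))
    (hX u₃)) (hX u₄)) (hX u₅)) (hX u₆)
  gcongr
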